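/- Let (V,φ) be a quaternary nondegenerate quadratic space over a number field F, L a g-maximal lattice in V, h∈V with φ[h]=q≠0, W=(Fh)^⊥, ψ=φ|_W. Then [(L∩W)~/(L∩W)] = 2q[L̃/L](2φ(h,L))⁻², and consequently the discriminant of the order A⁺(L∩W) is d(A⁺(L∩W)) = q[L̃/L](2φ(h,L))⁻²; moreover the discriminant of the quaternion algebra A⁺(W) divides q[L̃/L](2φ(h,L))⁻². -/

import Mathlib

noncomputable section

namespace Paper

variable (R F : Type*) [CommRing R] [Field F] [Algebra R F]

section Lattices

variable (W : Type*) [AddCommGroup W] [Module F W] [Module R W] [IsScalarTower R F W]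

/-- A `g`-lattice in `W`: a finitely generated `R`-submodule containing an `F`-basis. -/
def IsLat (L : Submodule R W) : Prop :=
  L.FG ∧ Submodule.span F (L : Set W) = ⊤

/-- integral lattice with respect to a bilinear form -/
def IsIntegralLat (ψ : LinearMap.BilinForm F W) (L : Submodule R W) : Prop :=
  IsLat R F W L ∧ ∀ x ∈ L, ψ x x ∈ (algebraMap R F).range

/-- maximal lattice with respect to a bilinear form -/
def IsMaximalLat (ψ : LinearMap.BilinForm F W) (L : Submodule R W) : Prop :=
  IsIntegralLat R F W ψ L ∧ ∀ L' : Submodule R W, IsIntegralLat R F W ψ L' → L ≤ L' → L' = L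

/-- the ideal `[L/M]` generated by determinants of `F`-automorphisms carrying `L` into `M` -/
def latIdx (L M : Submodule R W) : Submodule R F :=
  Submodule.span R {d : F | ∃ α : W ≃ₗ[F] W, (∀ x ∈ L, α x ∈ M) ∧
    LinearMap.det (α : W →ₗ[F] W) = d}

/-- the dual lattice `L~ = {x | 2ψ(x,L) ⊆ g}` -/
def dualLat (ψ : LinearMap.BilinForm F W) (L : Submodule R W) : Submodule R W :=
  ⨅ y ∈ L, Submodule.comap (((2 : F) • (ψ.flip y)).restrictScalars R)
    (LinearMap.range (Algebra.linearMap R F))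

/-- the ideal `[L/M]` for lattices spanning the subspace `U`, computed inside `U` -/
def latIdxIn (U : Submodule F W) (L M : Submodule R W) : Submodule R F :=
  latIdx R F ↥U (Submodule.comap ((U.subtype).restrictScalars R) L)
    (Submodule.comap ((U.subtype).restrictScalars R) M)

/-- product of a fractional ideal and a lattice -/
def idSMul {M : Type*} [AddCommGroup M] [Module F M] [Module R M] [IsScalarTower R F M]
    (I : Submodule R F) (N : Submodule R M) : Submodule R M :=
  Submodule.span R {z : M | ∃ c ∈ I, ∃ x ∈ N, z = c • x}

end Lattices

/-- the fractional ideal attached to an integral ideal -/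
def idealToF (I : Ideal R) : Submodule R F :=
  Submodule.map (Algebra.linearMap R F) I

section Clifford

variable (W : Type*) [AddCommGroup W] [Module F W] [Module R W] [IsScalarTower R F W]
variable (Q : QuadraticForm F W)

/-- the order `A(N)` generated by `g` and `N` in the Clifford algebra -/
def cliffordOrder (N : Submodule R W) : Subalgebra R (CliffordAlgebra Q) :=
  Algebra.adjoin R (CliffordAlgebra.ι Q '' (N : Set W))

/-- the even Clifford algebra, as an `R`-subalgebra -/
def evenR : Subalgebra R (CliffordAlgebra Q) :=
  (CliffordAlgebra.even Q).restrictScalars R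

/-- `A⁺(N) = A⁺(W) ∩ A(N)` -/
def APlus (N : Submodule R W) : Subalgebra R (CliffordAlgebra Q) :=
  evenR R F W Q ⊓ cliffordOrder R F W Q N

def APlusSub (N : Submodule R W) : Submodule R (CliffordAlgebra Q) :=
  Subalgebra.toSubmodule (APlus R F W Q N)

def oneLat : Submodule R (CliffordAlgebra Q) :=
  LinearMap.range (Algebra.linearMap R (CliffordAlgebra Q))

/-- the `R`-linear map `x ↦ 2ν(x,y) = x·y* + y·x*`, where `*` is the canonical
involution (reversal) of the Clifford algebra -/
def traceMap (y : CliffordAlgebra Q) : CliffordAlgebra Q →ₗ[R] CliffordAlgebra Q :=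
  ((LinearMap.mulRight F (CliffordAlgebra.reverse (Q := Q) y)) +
    (LinearMap.mulLeft F y) ∘ₗ (CliffordAlgebra.reverse (Q := Q))).restrictScalars R

/-- the dual `o~ = {x ∈ A⁺(W) | 2ν(x,o) ⊆ g}` with respect to the norm form
`ν[x] = x x*` of the even Clifford algebra -/
def normDual (o : Submodule R (CliffordAlgebra Q)) : Submodule R (CliffordAlgebra Q) :=
  Subalgebra.toSubmodule (evenR R F W Q) ⊓
    ⨅ y ∈ o, Submodule.comap (traceMap R F W Q y) (oneLat R F W Q)

/-- `A⁺(W)° = {x ∈ A⁺(W) | x* = -x}`, as an `R`-submodule -/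
def minusPart : Submodule R (CliffordAlgebra Q) :=
  Subalgebra.toSubmodule (evenR R F W Q) ⊓
    LinearMap.ker ((CliffordAlgebra.reverse (Q := Q) + LinearMap.id).restrictScalars R)

end Clifford

end Paper

namespace Paper

section Orders

variable (R F : Type*) [CommRing R] [Field F] [Algebra R F]
variable (A : Type*) [Ring A] [Algebra F A] [Algebra R A] [IsScalarTower R F A]

/-- an order in the `F`-subalgebra `B` of `A`: an `R`-subalgebra which is an `R`-lattice
in `B` -/
def IsOrderIn (B : Subalgebra F A) (o : Subalgebra R A) : Prop :=
  (Subalgebra.toSubmodule o).FG ∧ (o : Set A) ⊆ (B : Set A) ∧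
    Submodule.span F (o : Set A) = Subalgebra.toSubmodule B

/-- a maximal order in `B` -/
def IsMaximalOrderIn (B : Subalgebra F A) (o : Subalgebra R A) : Prop :=
  IsOrderIn R F A B o ∧ ∀ o' : Subalgebra R A, IsOrderIn R F A B o' → o ≤ o' → o' = o

end Orders

section Abbrev

variable (R F : Type*) [CommRing R] [Field F] [Algebra R F]
variable (W : Type*) [AddCommGroup W] [Module F W] [Module R W] [IsScalarTower R F W]
variable (psi : LinearMap.BilinForm F W)

/-- the ideal `[A⁺(M)/A⁺(N)]`, computed inside the quaternion algebra `A⁺(W)` -/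
def APlusIdx (M N : Submodule R W) : Submodule R F :=
  latIdxIn R F (CliffordAlgebra (LinearMap.BilinMap.toQuadraticMap psi))
    (Subalgebra.toSubmodule
      (CliffordAlgebra.even (LinearMap.BilinMap.toQuadraticMap psi)))
    (APlusSub R F W (LinearMap.BilinMap.toQuadraticMap psi) M)
    (APlusSub R F W (LinearMap.BilinMap.toQuadraticMap psi) N)

/-- the ideal `[A⁺(N)~/A⁺(N)]`, computed inside the quaternion algebra `A⁺(W)` -/
def APlusDualIdx (N : Submodule R W) : Submodule R F :=
  latIdxIn R F (CliffordAlgebra (LinearMap.BilinMap.toQuadraticMap psi))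
    (Subalgebra.toSubmodule
      (CliffordAlgebra.even (LinearMap.BilinMap.toQuadraticMap psi)))
    (normDual R F W (LinearMap.BilinMap.toQuadraticMap psi)
      (APlusSub R F W (LinearMap.BilinMap.toQuadraticMap psi) N))
    (APlusSub R F W (LinearMap.BilinMap.toQuadraticMap psi) N)

/-- the fractional ideal `2⁻¹·[Ñ/N]` -/
def halfDualIdx (N : Submodule R W) : Submodule R F :=
  Submodule.span R {((2 : F)⁻¹)} * latIdx R F W (dualLat R F W psi N) N

end Abbrev

end Paper

open Paper NumberField IsDedekindDomain

namespace Paper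

section LocalGenerators

variable {R F : Type*} [CommRing R] [Field F] [Algebra R F]

/-- The elements of `F` that become multiples of `g` after localizing at the prime `P`. -/
def locSpan (P : Ideal R) [P.IsPrime] (g : F) : Submodule R F where
  carrier := {d | ∃ t ∉ P, ∃ r : R, t • d = r • g}
  zero_mem' := ⟨1, P.one_notMem, 0, by simp⟩
  add_mem' := by
    rintro a b ⟨t, ht, r, hr⟩ ⟨t', ht', r', hr'⟩
    refine ⟨t * t', P.primeCompl.mul_mem ht ht', t' * r + t * r', ?_⟩
    rw [smul_add, mul_comm t t', mul_smul t', hr, mul_comm t' t, mul_smul t, hr', add_smul,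
      mul_smul, mul_smul]
  smul_mem' := by
    rintro c x ⟨t, ht, r, hr⟩
    exact ⟨t, ht, c * r, by rw [smul_comm, hr, mul_smul]⟩

/-- `g` generates the submodule `I` of `F` after localizing at the prime `P`. -/
structure IsLocGen (P : Ideal R) [P.IsPrime] (I : Submodule R F) (g : F) : Prop where
  smul_mem : ∃ s ∉ P, s • g ∈ I
  le_locSpan : I ≤ locSpan P g

theorem isLocGen_span_singleton (P : Ideal R) [P.IsPrime] (g : F) :
    IsLocGen P (Submodule.span R {g}) g where
  smul_mem := ⟨1, P.one_notMem, by simp⟩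
  le_locSpan := by
    rw [Submodule.span_singleton_le_iff_mem]
    exact ⟨1, P.one_notMem, 1, rfl⟩

theorem IsLocGen.mul {P : Ideal R} [P.IsPrime] {I J : Submodule R F} {g g' : F}
    (hI : IsLocGen P I g) (hJ : IsLocGen P J g') : IsLocGen P (I * J) (g * g') where
  smul_mem := by
    obtain ⟨s, hs, h⟩ := hI.smul_mem
    obtain ⟨s', hs', h'⟩ := hJ.smul_mem
    refine ⟨s * s', P.primeCompl.mul_mem hs hs', ?_⟩
    rw [← smul_mul_smul_comm]
    exact Submodule.mul_mem_mul h h'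
  le_locSpan := by
    rw [Submodule.mul_le]
    intro m hm n hn
    obtain ⟨t, ht, r, hr⟩ := hI.le_locSpan hm
    obtain ⟨t', ht', r', hr'⟩ := hJ.le_locSpan hn
    exact ⟨t * t', P.primeCompl.mul_mem ht ht', r * r', by
      rw [← smul_mul_smul_comm, hr, hr', smul_mul_smul_comm]⟩

theorem le_of_forall_exists_smul_mem {I J : Submodule R F}
    (h : ∀ (P : Ideal R) [P.IsMaximal], ∃ g : F, IsLocGen P I g ∧ ∃ s ∉ P, s • g ∈ J) :
    I ≤ J := by
  intro d hd
  by_contra hdJ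
  obtain ⟨P, hP, hle⟩ := Ideal.exists_le_maximal
    (Submodule.comap (LinearMap.toSpanSingleton R F d) J) (by
      rw [Ideal.ne_top_iff_one]
      simpa using hdJ)
  obtain ⟨g, hg, s, hs, hsJ⟩ := h P
  obtain ⟨t, ht, r, hr⟩ := hg.le_locSpan hd
  refine P.primeCompl.mul_mem hs ht (hle ?_)
  rw [Submodule.mem_comap, LinearMap.toSpanSingleton_apply, mul_smul, hr, smul_comm]
  exact J.smul_mem _ hsJ

theorem le_of_forall_isLocGen {I J : Submodule R F}
    (h : ∀ (P : Ideal R) [P.IsMaximal], ∃ g g' : F, IsLocGen P I g ∧ IsLocGen P J g' ∧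
      g ∈ locSpan P g') : I ≤ J := by
  refine le_of_forall_exists_smul_mem fun P _ ↦ ?_
  obtain ⟨g, g', hg, hg', t, ht, r, hr⟩ := h P
  obtain ⟨s, hs, hsJ⟩ := hg'.smul_mem
  refine ⟨g, hg, s * t, P.primeCompl.mul_mem hs ht, ?_⟩
  rw [mul_smul, hr, smul_comm]
  exact J.smul_mem _ hsJ

theorem eq_of_forall_isLocGen {I J : Submodule R F}
    (h : ∀ (P : Ideal R) [P.IsMaximal], ∃ g : F, IsLocGen P I g ∧ IsLocGen P J g) : I = J := by
  refine le_antisymm (le_of_forall_isLocGen fun P _ ↦ ?_) (le_of_forall_isLocGen fun P _ ↦ ?_) <;>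
  obtain ⟨g, h₁, h₂⟩ := h P
  · exact ⟨g, g, h₁, h₂, 1, P.one_notMem, 1, rfl⟩
  · exact ⟨g, g, h₂, h₁, 1, P.one_notMem, 1, rfl⟩

end LocalGenerators

section LocalBases

variable {R F : Type*} [CommRing R] [Field F] [Algebra R F]
variable {W : Type*} [AddCommGroup W] [Module F W] [Module R W] [IsScalarTower R F W]
variable {ι : Type*}

/-- The basis `b` of `W` is a basis of `L` after localizing at `P`. -/
structure IsLocBasis (P : Ideal R) (L : Submodule R W) (b : Module.Basis ι F W) : Prop where
  smul_mem : ∃ s ∉ P, ∀ i, s • b i ∈ L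
  repr_mem : ∃ s ∉ P, ∀ x ∈ L, ∀ i, s • b.repr x i ∈ (algebraMap R F).range

theorem algebraMap_ne_zero_of_notMem [IsDomain R] [IsFractionRing R F] {P : Ideal R} {s : R}
    (hs : s ∉ P) : algebraMap R F s ≠ 0 := by
  rw [Ne, FaithfulSMul.algebraMap_eq_zero_iff]
  rintro rfl
  exact hs P.zero_mem

theorem smul_eq_algebraMap_smul (s : R) (x : W) : s • x = algebraMap R F s • x :=
  (algebraMap_smul F s x).symm

variable [Fintype ι] [DecidableEq ι]

theorem isLocGen_latIdx [IsDomain R] [IsFractionRing R F] {P : Ideal R} [P.IsPrime]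
    {L M : Submodule R W} {b c : Module.Basis ι F W}
    (hb : IsLocBasis P L b) (hc : IsLocBasis P M c) :
    IsLocGen P (latIdx R F W L M) (b.det c) where
  smul_mem := by
    obtain ⟨s, hs, hsb⟩ := hb.repr_mem
    obtain ⟨t, ht, htc⟩ := hc.smul_mem
    have hst : s * t ∉ P := P.primeCompl.mul_mem hs ht
    have hu : algebraMap R F (s * t) ≠ 0 := algebraMap_ne_zero_of_notMem hst
    let α : W ≃ₗ[F] W := (b.equiv c (Equiv.refl ι)).trans
      (LinearEquiv.smulOfNeZero F W _ hu)
    have hα (i) : α (b i) = algebraMap R F (s * t) • c i := by simp [α]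
    refine ⟨(s * t) ^ Fintype.card ι, P.primeCompl.pow_mem hst _, Submodule.subset_span
      ⟨α, fun x hx ↦ ?_, ?_⟩⟩
    · rw [← b.sum_repr x, map_sum]
      refine Submodule.sum_mem _ fun i _ ↦ ?_
      obtain ⟨r, hr⟩ := hsb x hx i
      have h : b.repr x i • algebraMap R F (s * t) • c i = r • t • c i := by
        rw [← algebraMap_smul F r, ← algebraMap_smul F t (c i), hr, smul_smul, smul_smul]
        congr 1
        simp only [Algebra.smul_def, map_mul]
        ring
      rw [map_smul, hα, h]
      exact M.smul_mem _ (htc i)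
    · have h1 := b.det_comp (α : W →ₗ[F] W) b
      rw [b.det_self, mul_one] at h1
      rw [← h1]
      have h2 : (⇑(α : W →ₗ[F] W) ∘ ⇑b) = fun i ↦ algebraMap R F (s * t) • c i := funext hα
      rw [h2, AlternatingMap.map_smul_univ]
      simp [Algebra.smul_def]
  le_locSpan := by
    rw [latIdx, Submodule.span_le]
    rintro _ ⟨α, hα, rfl⟩
    obtain ⟨s, hs, hsb⟩ := hb.smul_mem
    obtain ⟨t, ht, htc⟩ := hc.repr_mem
    choose r hr using fun i j ↦ htc _ (hα _ (hsb i)) j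
    refine ⟨(s * t) ^ Fintype.card ι, P.primeCompl.pow_mem (P.primeCompl.mul_mem hs ht) _,
      (Matrix.of r).det, ?_⟩
    have h1 := c.det_comp (α : W →ₗ[F] W) b
    have h2 : c.det b * b.det c = 1 := by
      rw [c.det_apply, b.det_apply, ← Matrix.det_mul, c.toMatrix_mul_toMatrix_flip b,
        Matrix.det_one]
    have h3 : algebraMap R F (Matrix.of r).det =
        algebraMap R F (s * t) ^ Fintype.card ι * c.det (⇑(α : W →ₗ[F] W) ∘ ⇑b) := by
      rw [c.det_apply, ← Matrix.det_smul, RingHom.map_det, ← Matrix.det_transpose]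
      congr 1
      ext i j
      simp only [RingHom.mapMatrix_apply, Matrix.transpose_apply, Matrix.map_apply,
        Matrix.of_apply, hr, Matrix.smul_apply, Module.Basis.toMatrix_apply, Function.comp,
        smul_eq_algebraMap_smul (F := F) s, map_smul, Finsupp.smul_apply, smul_eq_mul,
        Algebra.smul_def, map_mul, LinearEquiv.coe_coe]
      ring
    calc (s * t) ^ Fintype.card ι • LinearMap.det (α : W →ₗ[F] W)
        = algebraMap R F (s * t) ^ Fintype.card ι *
          (LinearMap.det (α : W →ₗ[F] W) * c.det b) * b.det c := by
            rw [Algebra.smul_def, map_pow]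
            linear_combination (-(algebraMap R F (s * t) ^ Fintype.card ι) *
              (LinearMap.det (α : W →ₗ[F] W))) * h2
      _ = (Matrix.of r).det • b.det c := by rw [← h1, ← h3, Algebra.smul_def]

theorem mem_dualLat {ψ : LinearMap.BilinForm F W} {L : Submodule R W} {x : W} :
    x ∈ dualLat R F W ψ L ↔ ∀ y ∈ L, 2 * ψ x y ∈ (algebraMap R F).range := by
  simp [dualLat, Submodule.mem_iInf]

theorem IsLocBasis.dualLat {P : Ideal R} {L : Submodule R W}
    {b : Module.Basis ι F W} (hb : IsLocBasis P L b) [P.IsPrime] {ψ : LinearMap.BilinForm F W}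
    (hψ : ((2 : F) • ψ).Nondegenerate) :
    IsLocBasis P (dualLat R F W ψ L) (LinearMap.BilinForm.dualBasis ((2 : F) • ψ) hψ b) where
  smul_mem := by
    obtain ⟨s, hs, hsb⟩ := hb.repr_mem
    refine ⟨s, hs, fun i ↦ mem_dualLat.2 fun y hy ↦ ?_⟩
    have h : 2 * ψ (s • LinearMap.BilinForm.dualBasis ((2 : F) • ψ) hψ b i) y =
        s • b.repr y i := by
      have h1 : ∀ j, ((2 : F) • ψ) (LinearMap.BilinForm.dualBasis ((2 : F) • ψ) hψ b i) (b j) =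
          if j = i then 1 else 0 := LinearMap.BilinForm.apply_dualBasis_left hψ b i
      have h2 : ((2 : F) • ψ) (LinearMap.BilinForm.dualBasis ((2 : F) • ψ) hψ b i) y =
          b.repr y i := by
        conv_lhs => rw [← b.sum_repr y, map_sum]
        simp only [map_smul, h1]
        simp
      rw [← h2, smul_eq_algebraMap_smul (F := F)]
      simp [Algebra.smul_def]
      ring
    rw [h]
    exact hsb y hy i
  repr_mem := by
    obtain ⟨s, hs, hsb⟩ := hb.smul_mem
    refine ⟨s, hs, fun x hx i ↦ ?_⟩
    rw [LinearMap.BilinForm.dualBasis_repr_apply]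
    have := mem_dualLat.1 hx _ (hsb i)
    rw [smul_eq_algebraMap_smul (F := F), map_smul] at this
    convert this using 1
    simp [Algebra.smul_def]
    ring

theorem isLocGen_latIdx_dualLat [IsDomain R] [IsFractionRing R F] {P : Ideal R} [P.IsPrime]
    {L : Submodule R W} {b : Module.Basis ι F W} (hb : IsLocBasis P L b)
    {ψ : LinearMap.BilinForm F W} (hψ : ((2 : F) • ψ).Nondegenerate) :
    IsLocGen P (latIdx R F W (dualLat R F W ψ L) L)
      (Matrix.of fun i j ↦ 2 * ψ (b i) (b j)).det := by
  convert isLocGen_latIdx (hb.dualLat hψ) hb using 1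
  rw [Module.Basis.det_apply, ← Matrix.det_transpose]
  congr 1
  ext i j
  simp [Module.Basis.toMatrix_apply, LinearMap.BilinForm.dualBasis_repr_apply]

end LocalBases

theorem fg_comap_subtype {R F : Type*} [CommRing R] [IsNoetherianRing R] [Field F] [Algebra R F]
    {W : Type*} [AddCommGroup W] [Module F W] [Module R W]
    [IsScalarTower R F W] {L : Submodule R W} (hL : L.FG) (K : Submodule F W) :
    (Submodule.comap ((K.subtype).restrictScalars R) L).FG := by
  have hinj : Function.Injective ((K.subtype).restrictScalars R) := K.injective_subtype
  have : IsNoetherian R L := isNoetherian_of_fg_of_noetherian L hL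
  exact Submodule.fg_of_fg_map_injective _ hinj (hL.of_le (Submodule.map_comap_le _ _))

theorem exists_isLocBasis_finCons {R F : Type*} [CommRing R] [Field F] [Algebra R F]
    {W : Type*} [AddCommGroup W] [Module F W] [Module R W]
    [IsScalarTower R F W] {L : Submodule R W} {P : Ideal R} [P.IsPrime]
    {f : W →ₗ[F] F} {K : Submodule F W} (hK : K = LinearMap.ker f) {n : ℕ}
    {b : Module.Basis (Fin n) F K}
    (hb : IsLocBasis P (Submodule.comap ((K.subtype).restrictScalars R) L) b)
    (hbL : ∀ i, (b i : W) ∈ L) {y : W} (hy : y ∈ L) (hfy : f y ≠ 0)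
    (hLy : ∃ s ∉ P, ∀ x ∈ L, ∃ c : R, s • f x = c • f y) :
    ∃ b' : Module.Basis (Fin (n + 1)) F W, IsLocBasis P L b' ∧ b' 0 = y ∧
      ∀ i : Fin n, b' i.succ = b i := by
  subst hK
  have hli : ∀ (c : F), ∀ x ∈ LinearMap.ker f, c • y + x = 0 → c = 0 := by
    intro c x hx h
    have := congrArg f h
    rw [map_add, LinearMap.mem_ker.1 hx, map_smul, map_zero, add_zero, smul_eq_mul] at this
    exact (mul_eq_zero.1 this).resolve_right hfy
  have hsp : ∀ z : W, ∃ c : F, z + c • y ∈ LinearMap.ker f := by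
    intro z
    refine ⟨-(f z / f y), ?_⟩
    rw [LinearMap.mem_ker, map_add, map_smul, smul_eq_mul]
    field_simp
    ring
  have h0 : Module.Basis.mkFinCons y b hli hsp 0 = y := by simp
  have h1 (i : Fin n) : Module.Basis.mkFinCons y b hli hsp i.succ = b i := by simp
  generalize Module.Basis.mkFinCons y b hli hsp = B at h0 h1
  refine ⟨B, ⟨⟨1, P.one_notMem, fun i ↦ ?_⟩, ?_⟩, h0, h1⟩
  · rw [one_smul]
    refine Fin.cases ?_ (fun i ↦ ?_) i
    · rwa [h0]
    · rw [h1]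
      exact hbL i
  · obtain ⟨s, hs, hsL⟩ := hLy
    obtain ⟨t, ht, htb⟩ := hb.repr_mem
    refine ⟨t * s, P.primeCompl.mul_mem ht hs, fun x hx i ↦ ?_⟩
    obtain ⟨c, hc⟩ := hsL x hx
    have hz : s • x - c • y ∈ LinearMap.ker f := by
      rw [LinearMap.mem_ker, map_sub, smul_eq_algebraMap_smul (F := F) s,
        smul_eq_algebraMap_smul (F := F) c, map_smul, map_smul, algebraMap_smul, algebraMap_smul,
        hc, sub_self]
    have hzL : (⟨_, hz⟩ : LinearMap.ker f) ∈
        Submodule.comap (((LinearMap.ker f).subtype).restrictScalars R) L :=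
      L.sub_mem (L.smul_mem _ hx) (L.smul_mem _ hy)
    choose r hr using htb _ hzL
    have h2 : t • (s • x - c • y) = ∑ j, algebraMap R F (r j) • (b j : W) := by
      have h3 : ∑ j, b.repr ⟨_, hz⟩ j • (b j : W) = s • x - c • y := by
        simpa only [map_sum, map_smul, Submodule.subtype_apply] using
          congrArg (LinearMap.ker f).subtype (b.sum_repr ⟨_, hz⟩)
      rw [← h3, Finset.smul_sum]
      exact Finset.sum_congr rfl fun j _ ↦ by rw [hr, smul_assoc]
    have hx' : algebraMap R F (t * s) • x =
        ∑ k, (Fin.cons (algebraMap R F (t * c)) (algebraMap R F ∘ r) : Fin (n + 1) → F) k •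
          B k := by
      rw [Fin.sum_univ_succ]
      simp only [Fin.cons_zero, Fin.cons_succ, h0, h1, Function.comp, ← h2]
      rw [algebraMap_smul, algebraMap_smul, smul_sub, mul_smul, mul_smul]
      abel
    have h4 : (t * s) • B.repr x i =
        (Fin.cons (algebraMap R F (t * c)) (algebraMap R F ∘ r) : Fin (n + 1) → F) i := by
      rw [← B.repr_sum_self (Fin.cons (algebraMap R F (t * c)) (algebraMap R F ∘ r)), ← hx',
        map_smul, Finsupp.smul_apply, algebraMap_smul]
    rw [h4]
    exact Fin.cases ⟨t * c, rfl⟩ (fun i ↦ ⟨r i, rfl⟩) i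

section ExistenceOfLocalBases

variable {R F : Type*} [CommRing R] [IsDedekindDomain R] [Field F] [Algebra R F]
  [IsFractionRing R F]

theorem exists_smul_mem_of_mem_span {W : Type*} [AddCommGroup W] [Module F W] [Module R W]
    [IsScalarTower R F W] {L : Submodule R W} {x : W} (hx : x ∈ Submodule.span F (L : Set W)) :
    ∃ d : R, d ≠ 0 ∧ d • x ∈ L := by
  induction hx using Submodule.span_induction with
  | mem x hx => exact ⟨1, one_ne_zero, by simpa using hx⟩
  | zero => exact ⟨1, one_ne_zero, by simp⟩
  | add x y _ _ hx hy =>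
    obtain ⟨d, hd, hx⟩ := hx
    obtain ⟨e, he, hy⟩ := hy
    refine ⟨d * e, mul_ne_zero hd he, ?_⟩
    rw [smul_add, mul_smul d e y, mul_comm, mul_smul]
    exact L.add_mem (L.smul_mem _ hx) (L.smul_mem _ hy)
  | smul a x _ hx =>
    obtain ⟨d, hd, hx⟩ := hx
    obtain ⟨n, e, he, rfl⟩ := IsFractionRing.div_surjective (A := R) a
    have he' : algebraMap R F e ≠ 0 := by
      simpa using nonZeroDivisors.ne_zero he
    refine ⟨e * d, mul_ne_zero (nonZeroDivisors.ne_zero he) hd, ?_⟩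
    have : (e * d) • (algebraMap R F n / algebraMap R F e) • x = n • d • x := by
      rw [smul_eq_algebraMap_smul (F := F) (e * d), smul_eq_algebraMap_smul (F := F) n,
        smul_eq_algebraMap_smul (F := F) d, smul_smul, smul_smul, map_mul]
      congr 1
      field_simp
    rw [this]
    exact L.smul_mem _ hx

theorem span_comap_subtype_eq_top {W : Type*} [AddCommGroup W] [Module F W] [Module R W]
    [IsScalarTower R F W] {L : Submodule R W} (hL : Submodule.span F (L : Set W) = ⊤)
    (K : Submodule F W) :
    Submodule.span F ((Submodule.comap ((K.subtype).restrictScalars R) L : Submodule R K) :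
      Set K) = ⊤ := by
  rw [Submodule.eq_top_iff']
  intro x
  obtain ⟨d, hd, hx⟩ := exists_smul_mem_of_mem_span (L := L) (x := (x : W)) (by rw [hL]; trivial)
  have hd' : algebraMap R F d ≠ 0 := by simpa using hd
  have : x = (algebraMap R F d)⁻¹ • (d • x) := by
    rw [smul_eq_algebraMap_smul (F := F) d, smul_smul, inv_mul_cancel₀ hd', one_smul]
  rw [this]
  exact Submodule.smul_mem _ _ (Submodule.subset_span (by simpa using hx))

theorem exists_isLocGen_map {W : Type*} [AddCommGroup W] [Module F W] [Module R W]
    [IsScalarTower R F W] {L : Submodule R W} (hL : IsLat R F W L) (P : Ideal R) [P.IsPrime]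
    {f : W →ₗ[F] F} (hf : f ≠ 0) :
    ∃ y ∈ L, f y ≠ 0 ∧ ∃ s ∉ P, ∀ x ∈ L, ∃ c : R, s • f x = c • f y := by
  obtain ⟨w, hw, hfw⟩ : ∃ w ∈ L, f w ≠ 0 := by
    by_contra! h
    exact hf (LinearMap.ext_on hL.2 (by simpa [Set.EqOn] using h))
  let I : FractionalIdeal (nonZeroDivisors R) F :=
    ⟨Submodule.map (f.restrictScalars R) L, FractionalIdeal.isFractional_of_fg (hL.1.map _)⟩
  have hmem (x : F) : x ∈ I ↔ ∃ y ∈ L, f y = x := Iff.rfl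
  have hI : I ≠ 0 := by
    intro h
    have : f w ∈ I := (hmem _).2 ⟨w, hw, rfl⟩
    rw [h, FractionalIdeal.mem_zero_iff] at this
    exact hfw this
  have hmul : I * I⁻¹ = 1 := mul_inv_cancel₀ hI
  have key : ∃ y ∈ L, ∃ c ∈ I⁻¹, ∃ s ∉ P, f y * c = algebraMap R F s := by
    by_contra! h
    have hle : I * I⁻¹ ≤ (P : FractionalIdeal (nonZeroDivisors R) F) := by
      rw [FractionalIdeal.mul_le]
      intro i hi c hc
      obtain ⟨y, hy, rfl⟩ := (hmem i).1 hi
      have h1 : f y * c ∈ (1 : FractionalIdeal (nonZeroDivisors R) F) :=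
        hmul ▸ FractionalIdeal.mul_mem_mul hi hc
      obtain ⟨s, hs⟩ := (FractionalIdeal.mem_one_iff _).1 h1
      rw [FractionalIdeal.mem_coeIdeal]
      refine ⟨s, ?_, hs⟩
      by_contra hsP
      exact h y hy c hc s hsP hs.symm
    rw [hmul] at hle
    have h1 := hle (FractionalIdeal.one_mem_one _)
    rw [FractionalIdeal.mem_coeIdeal] at h1
    obtain ⟨s, hs, h1⟩ := h1
    rw [← map_one (algebraMap R F)] at h1
    rw [FaithfulSMul.algebraMap_injective R F h1] at hs
    exact P.one_notMem hs
  obtain ⟨y, hy, c, hc, s, hs, hsc⟩ := key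
  have hs0 : algebraMap R F s ≠ 0 := algebraMap_ne_zero_of_notMem hs
  refine ⟨y, hy, fun h ↦ hs0 (by rw [← hsc, h, zero_mul]), s, hs, fun x hx ↦ ?_⟩
  have h1 : f x * c ∈ (1 : FractionalIdeal (nonZeroDivisors R) F) :=
    hmul ▸ FractionalIdeal.mul_mem_mul ((hmem _).2 ⟨x, hx, rfl⟩) hc
  obtain ⟨r, hr⟩ := (FractionalIdeal.mem_one_iff _).1 h1
  refine ⟨r, ?_⟩
  rw [Algebra.smul_def, Algebra.smul_def, hr, ← hsc]
  ring

theorem exists_isLocBasis (P : Ideal R) [P.IsPrime] (n : ℕ) :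
    ∀ (W : Type*) [AddCommGroup W] [Module F W] [Module R W] [IsScalarTower R F W]
      [FiniteDimensional F W] (_ : Module.finrank F W = n) (L : Submodule R W)
      (_ : IsLat R F W L), ∃ b : Module.Basis (Fin n) F W, IsLocBasis P L b ∧ ∀ i, b i ∈ L := by
  induction n with
  | zero =>
    intro W _ _ _ _ _ hn L hL
    exact ⟨Module.finBasisOfFinrankEq F W hn, ⟨⟨1, P.one_notMem, fun i ↦ i.elim0⟩,
      1, P.one_notMem, fun _ _ i ↦ i.elim0⟩, fun i ↦ i.elim0⟩
  | succ n ih =>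
    intro W _ _ _ _ _ hn L hL
    let b₀ := Module.finBasisOfFinrankEq F W hn
    have hf : b₀.coord 0 ≠ 0 := fun h ↦ by simpa using LinearMap.congr_fun h (b₀ 0)
    obtain ⟨y, hy, hfy, hLy⟩ := exists_isLocGen_map hL P hf
    have hker : Module.finrank F (LinearMap.ker (b₀.coord 0)) = n := by
      have := Module.Dual.finrank_ker_add_one_of_ne_zero hf
      omega
    obtain ⟨b, hb, hbL⟩ := ih (LinearMap.ker (b₀.coord 0)) hker
      (Submodule.comap (((LinearMap.ker (b₀.coord 0)).subtype).restrictScalars R) L)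
      ⟨fg_comap_subtype hL.1 _, span_comap_subtype_eq_top hL.2 _⟩
    obtain ⟨b', hb', h0, h1⟩ := exists_isLocBasis_finCons rfl hb hbL hy hfy hLy
    refine ⟨b', hb', Fin.cases (h0 ▸ hy) fun i ↦ ?_⟩
    rw [h1]
    exact hbL i

end ExistenceOfLocalBases

section GramDeterminants

theorem det_gram_mul {F W : Type*} [Field F] [AddCommGroup W] [Module F W] {n : ℕ}
    (ψ : LinearMap.BilinForm F W) (b : Module.Basis (Fin (n + 1)) F W) {h : W}
    (h₁ : ∀ i : Fin n, ψ (b i.succ) h = 0) (h₂ : ∀ i : Fin n, ψ h (b i.succ) = 0) :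
    (Matrix.of fun i j ↦ ψ (b i) (b j)).det * ψ h h =
      ψ (b 0) h * ψ h (b 0) * (Matrix.of fun i j : Fin n ↦ ψ (b i.succ) (b j.succ)).det := by
  set G : Matrix (Fin (n + 1)) (Fin (n + 1)) F := Matrix.of fun i j ↦ ψ (b i) (b j) with hG
  have hGw : G.mulVec (b.repr h) = Pi.single 0 (ψ (b 0) h) := by
    have (i : Fin (n + 1)) : G.mulVec (b.repr h) i = ψ (b i) h := by
      conv_rhs => rw [← b.sum_repr h, map_sum]
      simp [Matrix.mulVec, dotProduct, hG, mul_comm]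
    refine funext fun i ↦ (this i).trans (Fin.cases (by simp) (fun i ↦ ?_) i)
    rw [h₁, Pi.single_eq_of_ne (Fin.succ_ne_zero i)]
  have hadj : G.det * b.repr h 0 = G.adjugate 0 0 * ψ (b 0) h := by
    have := congrFun (congrArg G.adjugate.mulVec hGw) 0
    rw [Matrix.mulVec_mulVec, Matrix.adjugate_mul, Matrix.smul_mulVec, Matrix.one_mulVec,
      Matrix.mulVec_single] at this
    simpa [mul_comm] using this
  have hh : ψ h h = b.repr h 0 * ψ h (b 0) := by
    conv_lhs => arg 2; rw [← b.sum_repr h]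
    rw [map_sum, Fin.sum_univ_succ]
    simp [h₂]
  have hadj' : G.adjugate 0 0 = (Matrix.of fun i j : Fin n ↦ ψ (b i.succ) (b j.succ)).det := by
    rw [Matrix.adjugate_fin_succ_eq_det_submatrix]
    simp [hG, Matrix.submatrix]
  rw [hh, ← hadj', ← mul_assoc, hadj]
  ring

/-- The half-discriminant of the ternary quadratic form
`a₁x² + a₂y² + a₃z² + dyz + exz + fxy`. -/
def halfDisc {R : Type*} [CommRing R] (a₁ a₂ a₃ d e f : R) : R :=
  4 * a₁ * a₂ * a₃ + d * e * f - a₁ * d ^ 2 - a₂ * e ^ 2 - a₃ * f ^ 2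

theorem map_halfDisc {R S : Type*} [CommRing R] [CommRing S] (g : R →+* S) (a₁ a₂ a₃ d e f : R) :
    g (halfDisc a₁ a₂ a₃ d e f) = halfDisc (g a₁) (g a₂) (g a₃) (g d) (g e) (g f) := by
  simp [halfDisc, map_ofNat]

/-- In the basis `m`, the quadratic form of `ψ` is
`a₁x² + a₂y² + a₃z² + dyz + exz + fxy`. -/
structure IsTernary {F W : Type*} [Field F] [AddCommGroup W] [Module F W]
    (ψ : LinearMap.BilinForm F W) (m : Fin 3 → W) (a₁ a₂ a₃ d e f : F) : Prop where
  symm : ψ.IsSymm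
  h₁ : ψ (m 0) (m 0) = a₁
  h₂ : ψ (m 1) (m 1) = a₂
  h₃ : ψ (m 2) (m 2) = a₃
  hd : 2 * ψ (m 1) (m 2) = d
  he : 2 * ψ (m 0) (m 2) = e
  hf : 2 * ψ (m 0) (m 1) = f

theorem IsTernary.det {F W : Type*} [Field F] [AddCommGroup W] [Module F W]
    {ψ : LinearMap.BilinForm F W} {m : Fin 3 → W} {a₁ a₂ a₃ d e f : F}
    (hm : IsTernary ψ m a₁ a₂ a₃ d e f) :
    (Matrix.of fun i j ↦ 2 * ψ (m i) (m j)).det = 2 * halfDisc a₁ a₂ a₃ d e f := by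
  rw [Matrix.det_fin_three]
  simp only [Matrix.of_apply, hm.symm.eq (m 1) (m 0), hm.symm.eq (m 2) (m 0),
    hm.symm.eq (m 2) (m 1), hm.h₁, hm.h₂, hm.h₃, hm.hd, hm.he, hm.hf, halfDisc]
  ring

theorem exists_ternary {R F V : Type*} [CommRing R] [IsDedekindDomain R] [Field F] [CharZero F]
    [Algebra R F] [IsFractionRing R F] [AddCommGroup V] [Module F V] [Module R V]
    [IsScalarTower R F V] (hV : Module.finrank F V = 4) {φ : LinearMap.BilinForm F V}
    (hsymm : φ.IsSymm) (hnd : φ.Nondegenerate) {h : V} (hq : φ h h ≠ 0) {U : Submodule F V}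
    (hU : U = LinearMap.ker (φ.flip h)) {L : Submodule R V} (hL : IsIntegralLat R F V φ L)
    (P : Ideal R) [P.IsPrime] :
    ∃ (m : Module.Basis (Fin 3) F U) (a₁ a₂ a₃ d e f : R) (c g : F),
      IsLocBasis P (Submodule.comap ((U.subtype).restrictScalars R) L) m ∧
      (∀ i, (m i : V) ∈ L) ∧
      IsTernary (φ.restrict U) m (algebraMap R F a₁) (algebraMap R F a₂) (algebraMap R F a₃)
        (algebraMap R F d) (algebraMap R F e) (algebraMap R F f) ∧
      halfDisc a₁ a₂ a₃ d e f ≠ 0 ∧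
      IsLocGen P (Submodule.map (((2 : F) • (φ h)).restrictScalars R) L) c ∧
      IsLocGen P (latIdx R F V (dualLat R F V φ L) L) g ∧
      IsLocGen P (latIdx R F U (dualLat R F U (φ.restrict U)
        (Submodule.comap ((U.subtype).restrictScalars R) L))
          (Submodule.comap ((U.subtype).restrictScalars R) L))
        (2 * algebraMap R F (halfDisc a₁ a₂ a₃ d e f)) ∧
      φ h h * g = algebraMap R F (halfDisc a₁ a₂ a₃ d e f) * (c * c) := by
  have : FiniteDimensional F V := Module.finite_of_finrank_pos (by omega)
  have hflip : φ.flip h = φ h := LinearMap.ext fun x ↦ by simp [hsymm.eq]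
  rw [hflip] at hU
  have hφh : φ h ≠ 0 := fun h0 ↦ hq (by simp [h0])
  have hU3 : Module.finrank F U = 3 := by
    have := Module.Dual.finrank_ker_add_one_of_ne_zero hφh
    rw [← hU] at this
    omega
  obtain ⟨m, hm, hmL⟩ := exists_isLocBasis P 3 U hU3
    (Submodule.comap ((U.subtype).restrictScalars R) L)
    ⟨fg_comap_subtype hL.1.1 _, span_comap_subtype_eq_top hL.1.2 _⟩
  obtain ⟨y, hy, hφy, hLy⟩ := exists_isLocGen_map hL.1 P hφh
  obtain ⟨b, hb, hb0, hbm⟩ := exists_isLocBasis_finCons hU hm hmL hy hφy hLy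
  have hLint {x z : V} (hx : x ∈ L) (hz : z ∈ L) : 2 * φ x z ∈ (algebraMap R F).range := by
    have h1 : 2 * φ x z = φ (x + z) (x + z) - φ x x - φ z z := by
      simp only [map_add, LinearMap.add_apply, hsymm.eq z x]
      ring
    rw [h1]
    exact sub_mem (sub_mem (hL.2 _ (L.add_mem hx hz)) (hL.2 _ hx)) (hL.2 _ hz)
  obtain ⟨a₁, h₁⟩ := hL.2 _ (hmL 0)
  obtain ⟨a₂, h₂⟩ := hL.2 _ (hmL 1)
  obtain ⟨a₃, h₃⟩ := hL.2 _ (hmL 2)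
  obtain ⟨d, hd⟩ := hLint (hmL 1) (hmL 2)
  obtain ⟨e, he⟩ := hLint (hmL 0) (hmL 2)
  obtain ⟨f, hf⟩ := hLint (hmL 0) (hmL 1)
  have hT : IsTernary (φ.restrict U) m (algebraMap R F a₁) (algebraMap R F a₂) (algebraMap R F a₃)
      (algebraMap R F d) (algebraMap R F e) (algebraMap R F f) :=
    ⟨⟨fun x z ↦ hsymm.eq x z⟩, h₁.symm, h₂.symm, h₃.symm, hd.symm, he.symm, hf.symm⟩
  have h2 : (2 : F) ≠ 0 := two_ne_zero
  have hφm (i : Fin 3) : φ h (m i) = 0 := by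
    have : (m i : V) ∈ LinearMap.ker (φ h) := hU ▸ (m i).2
    exact this
  have hgram := det_gram_mul ((2 : F) • φ) b (h := h)
    (fun i ↦ by rw [hbm]; simp [hsymm.eq _ h, hφm]) (fun i ↦ by rw [hbm]; simp [hφm])
  have hdet3 : (Matrix.of fun i j : Fin 3 ↦ ((2 : F) • φ) (b i.succ) (b j.succ)).det =
      2 * algebraMap R F (halfDisc a₁ a₂ a₃ d e f) := by
    rw [map_halfDisc, ← hT.det]
    simp [hbm]
  rw [hdet3, hb0] at hgram
  have hnd' : ((2 : F) • φ).Nondegenerate := by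
    rw [LinearMap.BilinForm.nondegenerate_iff_det_ne_zero b]
    have hdet := (LinearMap.BilinForm.nondegenerate_iff_det_ne_zero b).1 hnd
    rw [map_smul, Matrix.det_smul]
    exact mul_ne_zero (pow_ne_zero _ h2) hdet
  have hdet4 : (Matrix.of fun i j ↦ ((2 : F) • φ) (b i) (b j)).det ≠ 0 := by
    convert (LinearMap.BilinForm.nondegenerate_iff_det_ne_zero b).1 hnd' using 2
    ext i j
    simp [LinearMap.BilinForm.toMatrix_apply]
  have hH : algebraMap R F (halfDisc a₁ a₂ a₃ d e f) ≠ 0 := by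
    intro h0
    rw [h0, mul_zero, mul_zero] at hgram
    refine mul_ne_zero hdet4 ?_ hgram
    simpa using hq
  have hndU : ((2 : F) • φ.restrict U).Nondegenerate := by
    rw [LinearMap.BilinForm.nondegenerate_iff_det_ne_zero m]
    have : LinearMap.BilinForm.toMatrix m ((2 : F) • φ.restrict U) =
        Matrix.of fun i j ↦ 2 * φ.restrict U (m i) (m j) := by
      ext i j
      simp [LinearMap.BilinForm.toMatrix_apply]
    rw [this, hT.det, ← map_halfDisc]
    exact mul_ne_zero h2 hH
  refine ⟨m, a₁, a₂, a₃, d, e, f, 2 * φ h y, _, hm, hmL, hT, fun h0 ↦ hH (by rw [h0, map_zero]),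
    ⟨⟨1, P.one_notMem, ?_⟩, ?_⟩, isLocGen_latIdx_dualLat hb hnd', ?_, ?_⟩
  · rw [one_smul]
    exact ⟨y, hy, by simp⟩
  · rintro _ ⟨x, hx, rfl⟩
    obtain ⟨s, hs, hsL⟩ := hLy
    obtain ⟨r, hr⟩ := hsL x hx
    refine ⟨s, hs, r, ?_⟩
    simp only [LinearMap.coe_restrictScalars, LinearMap.smul_apply, smul_eq_mul]
    rw [← mul_smul_comm, hr, mul_smul_comm]
  · rw [map_halfDisc, ← hT.det]
    exact isLocGen_latIdx_dualLat hm hndU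
  · have h4 : (Matrix.of fun i j ↦ 2 * φ (b i) (b j)).det =
        (Matrix.of fun i j ↦ ((2 : F) • φ) (b i) (b j)).det := by simp
    rw [h4]
    refine mul_left_cancel₀ h2 ?_
    simp only [LinearMap.smul_apply, smul_eq_mul, hsymm.eq y h] at hgram ⊢
    linear_combination hgram

end GramDeterminants

section Adjoin

variable {S A : Type*} [CommRing S] [Ring A] [Algebra S A]

theorem adjoin_insert_le {s : Set A} {g : A} (hg : g * g ∈ (algebraMap S A).range)
    (hs : ∀ x ∈ s, x * g + g * x ∈ (algebraMap S A).range) :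
    Subalgebra.toSubmodule (Algebra.adjoin S (insert g s)) ≤
      Subalgebra.toSubmodule (Algebra.adjoin S s) ⊔
        (Subalgebra.toSubmodule (Algebra.adjoin S s)).map (LinearMap.mulLeft S g) := by
  set T := Algebra.adjoin S s with hT
  set N := Subalgebra.toSubmodule T ⊔ (Subalgebra.toSubmodule T).map (LinearMap.mulLeft S g)
  have hN {n : A} : n ∈ N ↔ ∃ t ∈ T, ∃ t' ∈ T, t + g * t' = n := by
    simp [N, Submodule.mem_sup]
  have key : ∀ w ∈ Algebra.adjoin S (insert g s), ∀ n ∈ N, w * n ∈ N := by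
    intro w hw
    induction hw using Algebra.adjoin_induction with
    | mem x hx =>
      intro n hn
      obtain ⟨t, ht, t', ht', rfl⟩ := hN.1 hn
      rcases hx with rfl | hx
      · obtain ⟨c, hc⟩ := hg
        exact hN.2 ⟨_, T.mul_mem (T.algebraMap_mem c) ht', t, ht, by rw [hc]; noncomm_ring⟩
      · obtain ⟨c, hc⟩ := hs x hx
        have hxT : x ∈ T := Algebra.subset_adjoin hx
        refine hN.2 ⟨_, T.add_mem (T.mul_mem hxT ht) (T.mul_mem (T.algebraMap_mem c) ht'), _,
          T.neg_mem (T.mul_mem hxT ht'), ?_⟩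
        rw [hc]
        noncomm_ring
    | algebraMap r =>
      intro n hn
      rw [← Algebra.smul_def]
      exact N.smul_mem r hn
    | add x y _ _ hx hy =>
      intro n hn
      rw [add_mul]
      exact N.add_mem (hx n hn) (hy n hn)
    | mul x y _ _ hx hy =>
      intro n hn
      rw [mul_assoc]
      exact hx _ (hy n hn)
  intro w hw
  rw [← mul_one w]
  exact key w hw 1 (hN.2 ⟨1, T.one_mem, 0, T.zero_mem, by simp⟩)

theorem fg_adjoin_of_mul_add_mul_mem [IsNoetherianRing S] {s : Set A} (hs : s.Finite)
    (h : ∀ x ∈ s, x * x ∈ (algebraMap S A).range)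
    (h' : ∀ x ∈ s, ∀ y ∈ s, x * y + y * x ∈ (algebraMap S A).range) :
    (Subalgebra.toSubmodule (Algebra.adjoin S s)).FG := by
  induction s, hs using Set.Finite.induction_on with
  | empty =>
    rw [Algebra.adjoin_empty, Algebra.toSubmodule_bot]
    exact ⟨{1}, by simp [Submodule.one_eq_span]⟩
  | @insert g s _ _ ih =>
    have hfg := ih (fun x hx ↦ h x (Set.mem_insert_of_mem g hx))
      fun x hx y hy ↦ h' x (Set.mem_insert_of_mem g hx) y (Set.mem_insert_of_mem g hy)
    exact (hfg.sup (hfg.map _)).of_le (adjoin_insert_le (h g (Set.mem_insert g s))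
      fun x hx ↦ h' x (Set.mem_insert_of_mem g hx) g (Set.mem_insert g s))

/-- If `x, y, z` satisfy Clifford relations over `S`, then the algebra they generate is spanned by
the standard monomials. -/
theorem adjoin_triple_le {x y z : A} {a₁ a₂ a₃ d e f : S} (hx : x * x = algebraMap S A a₁)
    (hy : y * y = algebraMap S A a₂) (hz : z * z = algebraMap S A a₃)
    (hyz : y * z + z * y = algebraMap S A d) (hxz : x * z + z * x = algebraMap S A e)
    (hxy : x * y + y * x = algebraMap S A f) :
    Subalgebra.toSubmodule (Algebra.adjoin S {x, y, z}) ≤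
      Submodule.span S (Set.range ![1, y * z, z * x, x * y]) ⊔
        Submodule.span S (Set.range ![x, y, z, x * (y * z)]) := by
  have h₁ : Subalgebra.toSubmodule (Algebra.adjoin S {z}) ≤ Submodule.span S {1, z} := by
    have := adjoin_insert_le (S := S) (s := ∅) (g := z) ⟨_, hz.symm⟩ (by simp)
    simp only [insert_empty_eq] at this
    refine this.trans ?_
    rw [Algebra.adjoin_empty, Algebra.toSubmodule_bot, Submodule.one_eq_span, Submodule.map_span,
      ← Submodule.span_union]
    exact Submodule.span_mono (by simp [Set.insert_subset_iff])
  have h₂ : Subalgebra.toSubmodule (Algebra.adjoin S {y, z}) ≤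
      Submodule.span S {1, z, y, y * z} := by
    refine (adjoin_insert_le ⟨_, hy.symm⟩ (by
      rintro _ rfl; exact ⟨d, by rw [← hyz, add_comm]⟩)).trans ?_
    refine (sup_le_sup h₁ (Submodule.map_mono h₁)).trans ?_
    rw [Submodule.map_span, ← Submodule.span_union]
    exact Submodule.span_mono (by simp [Set.insert_subset_iff, Set.image_insert_eq])
  have h₃ : Subalgebra.toSubmodule (Algebra.adjoin S {x, y, z}) ≤
      Submodule.span S {1, z, y, y * z, x, x * z, x * y, x * (y * z)} := by
    refine (adjoin_insert_le ⟨_, hx.symm⟩ (by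
      rintro _ (rfl | rfl)
      · exact ⟨f, by rw [← hxy, add_comm]⟩
      · exact ⟨e, by rw [← hxz, add_comm]⟩)).trans ?_
    refine (sup_le_sup h₂ (Submodule.map_mono h₂)).trans ?_
    rw [Submodule.map_span, ← Submodule.span_union]
    exact Submodule.span_mono (by simp [Set.insert_subset_iff, Set.image_insert_eq])
  refine h₃.trans (Submodule.span_le.2 ?_)
  have hE (i : Fin 4) : ![1, y * z, z * x, x * y] i ∈
      Submodule.span S (Set.range ![1, y * z, z * x, x * y]) ⊔
        Submodule.span S (Set.range ![x, y, z, x * (y * z)]) :=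
    Submodule.mem_sup_left (Submodule.subset_span ⟨i, rfl⟩)
  have hO (i : Fin 4) : ![x, y, z, x * (y * z)] i ∈
      Submodule.span S (Set.range ![1, y * z, z * x, x * y]) ⊔
        Submodule.span S (Set.range ![x, y, z, x * (y * z)]) :=
    Submodule.mem_sup_right (Submodule.subset_span ⟨i, rfl⟩)
  rintro _ (rfl | rfl | rfl | rfl | rfl | rfl | rfl | rfl)
  · exact hE 0
  · exact hO 2
  · exact hO 1
  · exact hE 1
  · exact hO 0
  · have : x * z = e • (1 : A) - z * x := by rw [← Algebra.algebraMap_eq_smul_one, ← hxz]; abel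
    rw [SetLike.mem_coe, this]
    exact sub_mem (Submodule.smul_mem _ _ (hE 0)) (hE 2)
  · exact hE 3
  · exact hO 3

end Adjoin

section EvenClifford

open CliffordAlgebra

variable {F W : Type*} [Field F] [AddCommGroup W] [Module F W] (Q : QuadraticForm F W)

/-- The monomials `1, m₁m₂, m₂m₀, m₀m₁` in the even Clifford algebra. -/
def evenMonomial (m : Fin 3 → W) : Fin 4 → CliffordAlgebra Q :=
  ![1, ι Q (m 1) * ι Q (m 2), ι Q (m 2) * ι Q (m 0), ι Q (m 0) * ι Q (m 1)]

theorem evenMonomial_mem (m : Fin 3 → W) (i : Fin 4) : evenMonomial Q m i ∈ evenOdd Q 0 := by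
  fin_cases i
  · exact one_le_evenOdd_zero Q (Submodule.one_le.1 le_rfl)
  all_goals exact ι_mul_ι_mem_evenOdd_zero Q _ _

theorem mem_span_evenMonomial {S : Type*} [CommRing S] [Algebra S F] [Module S W]
    [IsScalarTower S F W] {m : Fin 3 → W} {a₁ a₂ a₃ d e f : S} (h₁ : Q (m 0) = algebraMap S F a₁)
    (h₂ : Q (m 1) = algebraMap S F a₂) (h₃ : Q (m 2) = algebraMap S F a₃)
    (hd : QuadraticMap.polar Q (m 1) (m 2) = algebraMap S F d)
    (he : QuadraticMap.polar Q (m 0) (m 2) = algebraMap S F e)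
    (hf : QuadraticMap.polar Q (m 0) (m 1) = algebraMap S F f) {x : CliffordAlgebra Q}
    (hx : x ∈ Algebra.adjoin S {ι Q (m 0), ι Q (m 1), ι Q (m 2)}) (hx0 : x ∈ evenOdd Q 0) :
    x ∈ Submodule.span S (Set.range (evenMonomial Q m)) := by
  have hsc (c : S) : algebraMap F (CliffordAlgebra Q) (algebraMap S F c) =
      algebraMap S (CliffordAlgebra Q) c := (IsScalarTower.algebraMap_apply S F _ c).symm
  obtain ⟨u, hu, v, hv, rfl⟩ := Submodule.mem_sup.1 (adjoin_triple_le
    (by rw [ι_sq_scalar, h₁, hsc]) (by rw [ι_sq_scalar, h₂, hsc]) (by rw [ι_sq_scalar, h₃, hsc])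
    (by rw [ι_mul_ι_add_swap, hd, hsc]) (by rw [ι_mul_ι_add_swap, he, hsc])
    (by rw [ι_mul_ι_add_swap, hf, hsc]) hx)
  have hu0 : u ∈ evenOdd Q 0 := by
    have : Submodule.span S (Set.range (evenMonomial Q m)) ≤ (evenOdd Q 0).restrictScalars S := by
      rw [Submodule.span_le]
      rintro _ ⟨i, rfl⟩
      exact evenMonomial_mem Q m i
    exact this hu
  have hv1 : v ∈ evenOdd Q 1 := by
    refine (Submodule.span_le (p := (evenOdd Q 1).restrictScalars S)).2 ?_ hv
    rintro _ ⟨i, rfl⟩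
    fin_cases i
    · exact ι_mem_evenOdd_one Q _
    · exact ι_mem_evenOdd_one Q _
    · exact ι_mem_evenOdd_one Q _
    · exact evenOdd_mul_le Q 1 0 (Submodule.mul_mem_mul (ι_mem_evenOdd_one Q _)
        (ι_mul_ι_mem_evenOdd_zero Q _ _))
  have hv0 : v ∈ evenOdd Q 0 := (Submodule.add_mem_iff_right _ hu0).1 hx0
  have : v = 0 := (Submodule.disjoint_def.1 (evenOdd_isCompl Q).disjoint) v hv0 hv1
  rwa [this, add_zero]

theorem span_evenMonomial (m : Module.Basis (Fin 3) F W) :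
    Submodule.span F (Set.range (evenMonomial Q m)) = evenOdd Q 0 := by
  refine le_antisymm (Submodule.span_le.2 ?_) fun x hx ↦ mem_span_evenMonomial Q rfl rfl rfl rfl
    rfl rfl ?_ hx
  · rintro _ ⟨i, rfl⟩
    exact evenMonomial_mem Q m i
  · have : Algebra.adjoin F {ι Q (m 0), ι Q (m 1), ι Q (m 2)} = ⊤ := by
      rw [eq_top_iff, ← adjoin_range_ι]
      refine Algebra.adjoin_le ?_
      rintro _ ⟨w, rfl⟩
      rw [← m.sum_repr w, map_sum]
      refine Subalgebra.sum_mem _ fun i _ ↦ ?_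
      rw [map_smul]
      refine Subalgebra.smul_mem _ (Algebra.subset_adjoin ?_) _
      fin_cases i <;> simp
    rw [this]
    trivial

theorem algebraMap_cliffordAlgebra_injective [CharZero F] :
    Function.Injective (algebraMap F (CliffordAlgebra Q)) := by
  have : Invertible (2 : F) := invertibleOfNonzero two_ne_zero
  exact FaithfulSMul.algebraMap_injective _ _

theorem linearIndependent_evenMonomial [CharZero F] (m : Module.Basis (Fin 3) F W) :
    LinearIndependent F (evenMonomial Q m) := by
  have hinj := algebraMap_cliffordAlgebra_injective Q
  have hm (i j : Fin 3) : m.coord i (m j) = if j = i then 1 else 0 := by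
    simp [Finsupp.single_apply]
  rw [Fintype.linearIndependent_iff]
  intro c hc
  simp only [evenMonomial, Fin.sum_univ_four, Matrix.cons_val_zero, Matrix.cons_val_one,
    Matrix.cons_val] at hc
  have h2 := congrArg (contractLeft (Q := Q) (m.coord 2)) hc
  have h0 := congrArg (contractLeft (Q := Q) (m.coord 0)) hc
  simp only [map_add, map_smul, contractLeft_one, contractLeft_ι_mul, contractLeft_ι, hm,
    map_zero] at h0 h2
  have h21 := congrArg (contractLeft (Q := Q) (m.coord 1)) h2
  have h20 := congrArg (contractLeft (Q := Q) (m.coord 0)) h2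
  have h01 := congrArg (contractLeft (Q := Q) (m.coord 1)) h0
  simp [contractLeft_ι] at h21 h20 h01
  have hc1 : c 1 = 0 := hinj (by simpa [Algebra.algebraMap_eq_smul_one] using h21)
  have hc2 : c 2 = 0 := hinj (by simpa [Algebra.algebraMap_eq_smul_one] using h20)
  have hc3 : c 3 = 0 := hinj (by simpa [Algebra.algebraMap_eq_smul_one] using h01)
  have hc0 : c 0 = 0 := hinj (by simpa [hc1, hc2, hc3, Algebra.algebraMap_eq_smul_one] using hc)
  intro i
  fin_cases i <;> assumption

theorem exists_basis_even [CharZero F] (m : Module.Basis (Fin 3) F W) :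
    ∃ B : Module.Basis (Fin 4) F ↥(Subalgebra.toSubmodule (even Q)),
      ∀ i, (B i : CliffordAlgebra Q) = evenMonomial Q m i := by
  have hli := linearIndependent_evenMonomial Q m
  have hspan : Submodule.span F (Set.range (evenMonomial Q m)) =
      Subalgebra.toSubmodule (even Q) := by rw [span_evenMonomial, even_toSubmodule]
  exact ⟨(Module.Basis.span hli).map (LinearEquiv.ofEq _ _ hspan), fun i ↦ by
    rw [Module.Basis.map_apply]
    exact congrArg Subtype.val (Module.Basis.span_apply hli i)⟩

end EvenClifford

section CliffordOrderBasis

open CliffordAlgebra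

theorem exists_notMem_forall_repr_mem {R F W ι : Type*} [CommRing R] [Field F] [Algebra R F]
    [AddCommGroup W] [Module F W] [Module R W] [IsScalarTower R F W] {P : Ideal R} [P.IsPrime]
    {L : Submodule R W} (hL : L.FG) {b : Module.Basis ι F W}
    (h : ∀ x ∈ L, ∃ s ∉ P, ∀ i, s • b.repr x i ∈ (algebraMap R F).range) :
    ∃ s ∉ P, ∀ x ∈ L, ∀ i, s • b.repr x i ∈ (algebraMap R F).range := by
  have hsmul (r : R) (y : F) (hy : y ∈ (algebraMap R F).range) :
      r • y ∈ (algebraMap R F).range := by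
    rw [Algebra.smul_def]
    exact mul_mem ⟨r, rfl⟩ hy
  have hrepr (r : R) (x : W) (i : ι) : b.repr (r • x) i = r • b.repr x i := by
    rw [smul_eq_algebraMap_smul (F := F), map_smul, Finsupp.smul_apply, algebraMap_smul]
  refine Submodule.fg_induction (motive := fun N _ ↦ N ≤ L → ∃ s ∉ P, ∀ x ∈ N, ∀ i,
    s • b.repr x i ∈ (algebraMap R F).range) (fun x hx ↦ ?_) (fun N₁ N₂ _ _ h₁ h₂ hN ↦ ?_)
    L hL le_rfl
  · obtain ⟨s, hs, hsx⟩ := h x (hx (Submodule.mem_span_singleton_self x))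
    refine ⟨s, hs, fun y hy i ↦ ?_⟩
    obtain ⟨r, rfl⟩ := Submodule.mem_span_singleton.1 hy
    rw [hrepr, smul_comm]
    exact hsmul _ _ (hsx i)
  · obtain ⟨s, hs, hs'⟩ := h₁ (le_sup_left.trans hN)
    obtain ⟨t, ht, ht'⟩ := h₂ (le_sup_right.trans hN)
    refine ⟨s * t, P.primeCompl.mul_mem hs ht, fun x hx i ↦ ?_⟩
    obtain ⟨y, hy, z, hz, rfl⟩ := Submodule.mem_sup.1 hx
    rw [map_add, Finsupp.add_apply, smul_add, mul_smul, mul_smul, smul_comm s t]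
    exact add_mem (hsmul _ _ (hs' y hy i)) (hsmul _ _ (ht' z hz i))

variable {R F W : Type*} [CommRing R] [Field F] [Algebra R F]
  [AddCommGroup W] [Module F W] [Module R W] [IsScalarTower R F W] (Q : QuadraticForm F W)

theorem algebraMap_algebraMap_clifford (c : R) :
    algebraMap F (CliffordAlgebra Q) (algebraMap R F c) = algebraMap R (CliffordAlgebra Q) c :=
  (IsScalarTower.algebraMap_apply R F _ c).symm

theorem fg_cliffordOrder [IsNoetherianRing R] {M : Submodule R W} (hM : M.FG)
    (hQ : ∀ x ∈ M, Q x ∈ (algebraMap R F).range) :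
    (Subalgebra.toSubmodule (cliffordOrder R F W Q M)).FG := by
  obtain ⟨s, rfl⟩ := hM
  have hle : cliffordOrder R F W Q (Submodule.span R (s : Set W)) ≤
      Algebra.adjoin R (ι Q '' (s : Set W)) := by
    refine Algebra.adjoin_le ?_
    rintro _ ⟨x, hx, rfl⟩
    have : Submodule.span R (s : Set W) ≤ (Subalgebra.toSubmodule
        (Algebra.adjoin R (ι Q '' (s : Set W)))).comap ((ι Q).restrictScalars R) :=
      Submodule.span_le.2 fun y hy ↦ Algebra.subset_adjoin ⟨y, hy, rfl⟩
    exact this hx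
  refine (fg_adjoin_of_mul_add_mul_mem (s.finite_toSet.image _) ?_ ?_).of_le hle
  · rintro _ ⟨x, hx, rfl⟩
    obtain ⟨c, hc⟩ := hQ x (Submodule.subset_span hx)
    exact ⟨c, by rw [ι_sq_scalar, ← hc, algebraMap_algebraMap_clifford]⟩
  · rintro _ ⟨x, hx, rfl⟩ _ ⟨y, hy, rfl⟩
    have hx := Submodule.subset_span (R := R) hx
    have hy := Submodule.subset_span (R := R) hy
    obtain ⟨c, hc⟩ := sub_mem (sub_mem (hQ _ (add_mem hx hy)) (hQ x hx)) (hQ y hy)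
    exact ⟨c, by rw [ι_mul_ι_add_swap, QuadraticMap.polar, ← hc, algebraMap_algebraMap_clifford]⟩

theorem isLocBasis_APlus [IsNoetherianRing R] {M : Submodule R W} (hM : M.FG)
    (hQ : ∀ x ∈ M, Q x ∈ (algebraMap R F).range) {P : Ideal R} [P.IsPrime]
    {m : Module.Basis (Fin 3) F W} (hm : IsLocBasis P M m) (hmM : ∀ i, m i ∈ M)
    {B : Module.Basis (Fin 4) F ↥(Subalgebra.toSubmodule (even Q))}
    (hB : ∀ i, (B i : CliffordAlgebra Q) = evenMonomial Q m i) :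
    IsLocBasis P (Submodule.comap
      (((Subalgebra.toSubmodule (even Q)).subtype).restrictScalars R) (APlusSub R F W Q M)) B where
  smul_mem := by
    refine ⟨1, P.one_notMem, fun i ↦ ?_⟩
    rw [one_smul]
    refine ⟨(B i).2, ?_⟩
    simp only [LinearMap.coe_restrictScalars, Submodule.subtype_apply, hB]
    have hι (i : Fin 3) : ι Q (m i) ∈ cliffordOrder R F W Q M :=
      Algebra.subset_adjoin ⟨m i, hmM i, rfl⟩
    fin_cases i
    · exact one_mem _
    all_goals exact mul_mem (hι _) (hι _)
  repr_mem := by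
    have hfg : (APlusSub R F W Q M).FG := (fg_cliffordOrder Q hM hQ).of_le fun x hx ↦ hx.2
    refine exists_notMem_forall_repr_mem (fg_comap_subtype hfg _) fun x hx ↦ ?_
    obtain ⟨s, hs, hsm⟩ := hm.repr_mem
    have hpolar (i j : Fin 3) : QuadraticMap.polar Q (m i) (m j) ∈ (algebraMap R F).range :=
      sub_mem (sub_mem (hQ _ (add_mem (hmM i) (hmM j))) (hQ _ (hmM i))) (hQ _ (hmM j))
    obtain ⟨a₁, h₁⟩ := hQ _ (hmM 0)
    obtain ⟨a₂, h₂⟩ := hQ _ (hmM 1)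
    obtain ⟨a₃, h₃⟩ := hQ _ (hmM 2)
    obtain ⟨d, hd⟩ := hpolar 1 2
    obtain ⟨e, he⟩ := hpolar 0 2
    obtain ⟨f, hf⟩ := hpolar 0 1
    have key : ∀ w ∈ cliffordOrder R F W Q M, ∃ t ∉ P,
        t • w ∈ Algebra.adjoin R {ι Q (m 0), ι Q (m 1), ι Q (m 2)} := by
      intro w hw
      induction hw using Algebra.adjoin_induction with
      | mem w hw =>
        obtain ⟨y, hy, rfl⟩ := hw
        refine ⟨s, hs, ?_⟩
        have : s • ι Q y = ∑ i, (s • m.repr y i) • ι Q (m i) := by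
          conv_lhs => rw [← m.sum_repr y]
          simp only [map_sum, map_smul, Finset.smul_sum, smul_assoc]
        rw [this]
        refine Subalgebra.sum_mem _ fun i _ ↦ ?_
        obtain ⟨r, hr⟩ := hsm y hy i
        rw [← hr, algebraMap_smul]
        refine Subalgebra.smul_mem _ (Algebra.subset_adjoin ?_) _
        fin_cases i <;> simp
      | algebraMap r =>
          exact ⟨1, P.one_notMem, by rw [one_smul]; exact Subalgebra.algebraMap_mem _ r⟩
      | add w w' _ _ h h' =>
        obtain ⟨t, ht, h⟩ := h
        obtain ⟨t', ht', h'⟩ := h'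
        refine ⟨t * t', P.primeCompl.mul_mem ht ht', ?_⟩
        rw [smul_add, mul_smul t t' w', mul_comm, mul_smul]
        exact add_mem (Subalgebra.smul_mem _ h _) (Subalgebra.smul_mem _ h' _)
      | mul w w' _ _ h h' =>
        obtain ⟨t, ht, h⟩ := h
        obtain ⟨t', ht', h'⟩ := h'
        refine ⟨t * t', P.primeCompl.mul_mem ht ht', ?_⟩
        rw [← smul_mul_smul_comm]
        exact mul_mem h h'
    obtain ⟨t, ht, htx⟩ := key _ hx.2
    refine ⟨t, ht, fun i ↦ ?_⟩
    have hx0 : t • (x : CliffordAlgebra Q) ∈ evenOdd Q 0 := by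
      rw [Algebra.smul_def, ← algebraMap_algebraMap_clifford, ← Algebra.smul_def]
      exact Submodule.smul_mem _ _ x.2
    have hmem := mem_span_evenMonomial Q h₁.symm h₂.symm h₃.symm hd.symm he.symm hf.symm htx hx0
    obtain ⟨c, hc⟩ := (Submodule.mem_span_range_iff_exists_fun R).1 hmem
    have hc' : algebraMap R F t • x = ∑ i, algebraMap R F (c i) • B i := by
      refine Subtype.ext (Eq.trans (Eq.trans ?_ hc.symm) ?_)
      · rw [Submodule.coe_smul, algebraMap_smul]
        rfl
      · simp only [Submodule.coe_sum, Submodule.coe_smul (R := F), hB]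
        exact Finset.sum_congr rfl fun j _ ↦ (algebraMap_smul F (c j) _).symm
    refine ⟨c i, ?_⟩
    have := congrArg (fun z ↦ B.repr z i) hc'
    rw [map_smul, B.repr_sum_self, Finsupp.smul_apply, algebraMap_smul] at this
    exact this.symm

end CliffordOrderBasis

section NormForm

open CliffordAlgebra

/-- The Gram matrix of the norm form of the even Clifford algebra in the basis of even
monomials. -/
def normGram {F : Type*} [CommRing F] (a₁ a₂ a₃ d e f : F) : Matrix (Fin 4) (Fin 4) F :=
  !![2, d, e, f;
    d, 2 * a₂ * a₃, e * d - a₃ * f, d * f - a₂ * e;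
    e, e * d - a₃ * f, 2 * a₁ * a₃, e * f - a₁ * d;
    f, d * f - a₂ * e, e * f - a₁ * d, 2 * a₁ * a₂]

theorem det_normGram {F : Type*} [CommRing F] (a₁ a₂ a₃ d e f : F) :
    (normGram a₁ a₂ a₃ d e f).det = halfDisc a₁ a₂ a₃ d e f ^ 2 := by
  simp [normGram, halfDisc, Matrix.det_succ_row_zero, Fin.sum_univ_succ, Fin.succAbove]
  ring

variable {F A : Type*} [Field F] [Ring A] [Algebra F A]

theorem clifford_gram_identity {x y z : A} {a₁ a₂ a₃ d e f : F} (hx : x * x = algebraMap F A a₁)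
    (hy : y * y = algebraMap F A a₂) (hz : z * z = algebraMap F A a₃)
    (hyz : y * z + z * y = algebraMap F A d) (hxz : x * z + z * x = algebraMap F A e)
    (hxy : x * y + y * x = algebraMap F A f) (i j : Fin 4) :
    ![1, y * z, z * x, x * y] i * ![1, z * y, x * z, y * x] j +
      ![1, y * z, z * x, x * y] j * ![1, z * y, x * z, y * x] i =
      algebraMap F A (normGram a₁ a₂ a₃ d e f i j) := by
  rw [Algebra.algebraMap_eq_smul_one] at *
  have hx' (w : A) : x * (x * w) = a₁ • w := by rw [← mul_assoc, hx, smul_one_mul]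
  have hy' (w : A) : y * (y * w) = a₂ • w := by rw [← mul_assoc, hy, smul_one_mul]
  have hzy : z * y = d • (1 : A) - y * z := eq_sub_of_add_eq' hyz
  have hzx : z * x = e • (1 : A) - x * z := eq_sub_of_add_eq' hxz
  have hyx : y * x = f • (1 : A) - x * y := eq_sub_of_add_eq' hxy
  have hzy' (w : A) : z * (y * w) = d • w - y * (z * w) := by
    rw [← mul_assoc, hzy, sub_mul, smul_one_mul, mul_assoc]
  have hzx' (w : A) : z * (x * w) = e • w - x * (z * w) := by
    rw [← mul_assoc, hzx, sub_mul, smul_one_mul, mul_assoc]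
  have hyx' (w : A) : y * (x * w) = f • w - x * (y * w) := by
    rw [← mul_assoc, hyx, sub_mul, smul_one_mul, mul_assoc]
  fin_cases i <;> fin_cases j <;>
    simp [normGram, hx, hy, hz, hx', hy', hzy, hzx, hyx, hzy', hzx', hyx', mul_assoc,
      mul_sub, sub_mul] <;> module

variable {R W : Type*} [CommRing R] [Algebra R F]
  [AddCommGroup W] [Module F W] [Module R W] [IsScalarTower R F W] (Q : QuadraticForm F W)

/-- The bilinear form on the even Clifford algebra attached to the norm form. -/
def normBilin {Q : QuadraticForm F W}
    (B : Module.Basis (Fin 4) F ↥(Subalgebra.toSubmodule (even Q))) (a₁ a₂ a₃ d e f : F) :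
    LinearMap.BilinForm F ↥(Subalgebra.toSubmodule (even Q)) :=
  Matrix.toBilin B ((2 : F)⁻¹ • normGram a₁ a₂ a₃ d e f)

theorem two_mul_normBilin_basis [CharZero F] {Q : QuadraticForm F W}
    (B : Module.Basis (Fin 4) F ↥(Subalgebra.toSubmodule (even Q))) (a₁ a₂ a₃ d e f : F)
    (i j : Fin 4) :
    2 * normBilin B a₁ a₂ a₃ d e f (B i) (B j) = normGram a₁ a₂ a₃ d e f i j := by
  have h := congr_fun₂
    (LinearMap.BilinForm.toMatrix_toBilin B ((2 : F)⁻¹ • normGram a₁ a₂ a₃ d e f)) i j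
  rw [LinearMap.BilinForm.toMatrix_apply] at h
  rw [normBilin, h, Matrix.smul_apply, smul_eq_mul, mul_inv_cancel_left₀ two_ne_zero]

theorem mul_reverse_add_mul_reverse [CharZero F] {m : Fin 3 → W} {a₁ a₂ a₃ d e f : F}
    (h₁ : Q (m 0) = a₁) (h₂ : Q (m 1) = a₂) (h₃ : Q (m 2) = a₃)
    (hd : QuadraticMap.polar Q (m 1) (m 2) = d)
    (he : QuadraticMap.polar Q (m 0) (m 2) = e)
    (hf : QuadraticMap.polar Q (m 0) (m 1) = f)
    {B : Module.Basis (Fin 4) F ↥(Subalgebra.toSubmodule (even Q))}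
    (hB : ∀ i, (B i : CliffordAlgebra Q) = evenMonomial Q m i)
    (u v : ↥(Subalgebra.toSubmodule (even Q))) :
    (u : CliffordAlgebra Q) * reverse (v : CliffordAlgebra Q) +
        v * reverse (u : CliffordAlgebra Q) =
      algebraMap F _ (2 * normBilin B a₁ a₂ a₃ d e f u v) := by
  let E := (Subalgebra.toSubmodule (even Q)).subtype
  let T : LinearMap.BilinMap F ↥(Subalgebra.toSubmodule (even Q)) (CliffordAlgebra Q) :=
    (LinearMap.mul F (CliffordAlgebra Q)).compl₁₂ E (reverse ∘ₗ E)
  let T' : LinearMap.BilinMap F ↥(Subalgebra.toSubmodule (even Q)) (CliffordAlgebra Q) :=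
    (normBilin B a₁ a₂ a₃ d e f).compr₂ ((2 : F) • Algebra.linearMap F (CliffordAlgebra Q))
  have key : T + T.flip = T' := by
    refine B.ext fun i ↦ B.ext fun j ↦ ?_
    have := clifford_gram_identity (F := F) (x := ι Q (m 0)) (y := ι Q (m 1))
      (z := ι Q (m 2)) (by rw [ι_sq_scalar, h₁]) (by rw [ι_sq_scalar, h₂])
      (by rw [ι_sq_scalar, h₃]) (by rw [ι_mul_ι_add_swap, hd]) (by rw [ι_mul_ι_add_swap, he])
      (by rw [ι_mul_ι_add_swap, hf]) i j
    have hrev (k : Fin 4) : reverse (B k : CliffordAlgebra Q) =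
        ![1, ι Q (m 2) * ι Q (m 1), ι Q (m 0) * ι Q (m 2), ι Q (m 1) * ι Q (m 0)] k := by
      rw [hB]
      fin_cases k <;> simp [evenMonomial]
    simp only [T, T', E, LinearMap.add_apply, LinearMap.flip_apply, LinearMap.compl₁₂_apply,
      LinearMap.mul_apply', LinearMap.comp_apply, Submodule.subtype_apply, LinearMap.compr₂_apply,
      hrev, LinearMap.smul_apply, Algebra.linearMap_apply]
    rw [hB, hB]
    refine this.trans ?_
    rw [← two_mul_normBilin_basis B, map_mul, Algebra.smul_def]
  have := LinearMap.congr_fun (LinearMap.congr_fun key u) v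
  rw [map_mul, ← Algebra.smul_def]
  exact this

theorem comap_normDual [CharZero F] {m : Fin 3 → W} {a₁ a₂ a₃ d e f : F}
    (h₁ : Q (m 0) = a₁) (h₂ : Q (m 1) = a₂) (h₃ : Q (m 2) = a₃)
    (hd : QuadraticMap.polar Q (m 1) (m 2) = d)
    (he : QuadraticMap.polar Q (m 0) (m 2) = e)
    (hf : QuadraticMap.polar Q (m 0) (m 1) = f)
    {B : Module.Basis (Fin 4) F ↥(Subalgebra.toSubmodule (even Q))}
    (hB : ∀ i, (B i : CliffordAlgebra Q) = evenMonomial Q m i)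
    {o : Submodule R (CliffordAlgebra Q)}
    (ho : o ≤ (Subalgebra.toSubmodule (even Q)).restrictScalars R) :
    Submodule.comap (((Subalgebra.toSubmodule (even Q)).subtype).restrictScalars R)
        (normDual R F W Q o) =
      dualLat R F _ (normBilin B a₁ a₂ a₃ d e f)
        (Submodule.comap (((Subalgebra.toSubmodule (even Q)).subtype).restrictScalars R) o) := by
  have key (u v : ↥(Subalgebra.toSubmodule (even Q))) :
      traceMap R F W Q v u ∈ oneLat R F W Q ↔
        2 * normBilin B a₁ a₂ a₃ d e f u v ∈ (algebraMap R F).range := by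
    have h : traceMap R F W Q v u =
        algebraMap F _ (2 * normBilin B a₁ a₂ a₃ d e f u v) :=
      mul_reverse_add_mul_reverse Q h₁ h₂ h₃ hd he hf hB u v
    rw [h]
    constructor
    · rintro ⟨c, hc⟩
      refine ⟨c, algebraMap_cliffordAlgebra_injective Q ?_⟩
      rw [← hc, algebraMap_algebraMap_clifford]
      rfl
    · rintro ⟨c, hc⟩
      exact ⟨c, by rw [← hc, algebraMap_algebraMap_clifford]; rfl⟩
  ext u
  rw [mem_dualLat]
  simp only [normDual, Submodule.mem_comap, Submodule.mem_inf, Submodule.mem_iInf]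
  constructor
  · rintro ⟨-, h⟩ v hv
    exact (key u v).1 (h v hv)
  · exact fun h ↦ ⟨u.2, fun v hv ↦ (key u ⟨v, ho hv⟩).2 (h ⟨v, ho hv⟩ hv)⟩

theorem isLocGen_APlusDualIdx [CharZero F] [IsDomain R] [IsNoetherianRing R] [IsFractionRing R F]
    {ψ : LinearMap.BilinForm F W} {M : Submodule R W} (hM : M.FG)
    (hψM : ∀ x ∈ M, ψ x x ∈ (algebraMap R F).range) {P : Ideal R} [P.IsPrime]
    {m : Module.Basis (Fin 3) F W} (hm : IsLocBasis P M m) (hmM : ∀ i, m i ∈ M)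
    {a₁ a₂ a₃ d e f : F} (hT : IsTernary ψ m a₁ a₂ a₃ d e f)
    (hH : halfDisc a₁ a₂ a₃ d e f ≠ 0) :
    IsLocGen P (APlusDualIdx R F W ψ M) (halfDisc a₁ a₂ a₃ d e f ^ 2) := by
  obtain ⟨B, hB⟩ := exists_basis_even (LinearMap.BilinMap.toQuadraticMap ψ) m
  have hpolar (i j : Fin 3) :
      QuadraticMap.polar (LinearMap.BilinMap.toQuadraticMap ψ) (m i) (m j) = 2 * ψ (m i) (m j) := by
    rw [LinearMap.BilinMap.polar_toQuadraticMap, hT.symm.eq (m j) (m i)]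
    ring
  have hloc := isLocBasis_APlus (LinearMap.BilinMap.toQuadraticMap ψ) hM hψM hm hmM hB
  have hdet : (Matrix.of fun i j ↦ 2 * normBilin B a₁ a₂ a₃ d e f (B i) (B j)).det =
      halfDisc a₁ a₂ a₃ d e f ^ 2 := by
    rw [← det_normGram]
    congr 1
    ext i j
    exact two_mul_normBilin_basis B _ _ _ _ _ _ i j
  have hnd : ((2 : F) • normBilin B a₁ a₂ a₃ d e f).Nondegenerate := by
    rw [LinearMap.BilinForm.nondegenerate_iff_det_ne_zero B]
    convert pow_ne_zero 2 hH using 1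
    rw [← hdet]
    congr 1
    ext i j
    rw [LinearMap.BilinForm.toMatrix_apply]
    rfl
  have ho : APlusSub R F W (LinearMap.BilinMap.toQuadraticMap ψ) M ≤
      (Subalgebra.toSubmodule (even (LinearMap.BilinMap.toQuadraticMap ψ))).restrictScalars R :=
    fun x hx ↦ hx.1
  rw [APlusDualIdx, latIdxIn, comap_normDual _ hT.h₁ hT.h₂ hT.h₃ ((hpolar 1 2).trans hT.hd)
    ((hpolar 0 2).trans hT.he) ((hpolar 0 1).trans hT.hf) hB ho, ← hdet]
  exact isLocGen_latIdx_dualLat hloc hnd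

end NormForm

section Residue

/-- The ternary quadratic form with the given coefficients. -/
def ternaryForm {k : Type*} [CommRing k] (a₁ a₂ a₃ d e f : k) (x : Fin 3 → k) : k :=
  a₁ * x 0 ^ 2 + a₂ * x 1 ^ 2 + a₃ * x 2 ^ 2 + d * x 1 * x 2 + e * x 0 * x 2 + f * x 0 * x 1

/-- The gradient of `ternaryForm`. -/
def ternaryGrad {k : Type*} [CommRing k] (a₁ a₂ a₃ d e f : k) (x : Fin 3 → k) : Fin 3 → k :=
  ![2 * a₁ * x 0 + f * x 1 + e * x 2, f * x 0 + 2 * a₂ * x 1 + d * x 2,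
    e * x 0 + d * x 1 + 2 * a₃ * x 2]

theorem map_ternaryForm {k l : Type*} [CommRing k] [CommRing l] (g : k →+* l)
    (a₁ a₂ a₃ d e f : k) (x : Fin 3 → k) :
    g (ternaryForm a₁ a₂ a₃ d e f x) =
      ternaryForm (g a₁) (g a₂) (g a₃) (g d) (g e) (g f) (fun i ↦ g (x i)) := by
  simp [ternaryForm]

theorem map_ternaryGrad {k l : Type*} [CommRing k] [CommRing l] (g : k →+* l)
    (a₁ a₂ a₃ d e f : k) (x : Fin 3 → k) (j : Fin 3) :
    g (ternaryGrad a₁ a₂ a₃ d e f x j) =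
      ternaryGrad (g a₁) (g a₂) (g a₃) (g d) (g e) (g f) (fun i ↦ g (x i)) j := by
  fin_cases j <;> simp [ternaryGrad, map_ofNat]

/-- Chevalley's theorem for ternary quadratic forms over a finite field. -/
theorem exists_ne_zero_ternaryForm_eq_zero {k : Type*} [Field k] [Finite k]
    (a₁ a₂ a₃ d e f : k) : ∃ x : Fin 3 → k, x ≠ 0 ∧ ternaryForm a₁ a₂ a₃ d e f x = 0 := by
  classical
  have := Fintype.ofFinite k
  open MvPolynomial in
  let p : MvPolynomial (Fin 3) k := C a₁ * X 0 ^ 2 + C a₂ * X 1 ^ 2 + C a₃ * X 2 ^ 2 +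
    C d * X 1 * X 2 + C e * X 0 * X 2 + C f * X 0 * X 1
  have heval (x : Fin 3 → k) : MvPolynomial.eval x p = ternaryForm a₁ a₂ a₃ d e f x := by
    simp [p, ternaryForm]
  have hhom : p.IsHomogeneous 2 := by
    open MvPolynomial in
    have hC (a : k) : (C a : MvPolynomial (Fin 3) k).IsHomogeneous 0 := isHomogeneous_C _ a
    have hX (i : Fin 3) : (X i : MvPolynomial (Fin 3) k).IsHomogeneous 1 := isHomogeneous_X k i
    have hsq (a : k) (i : Fin 3) : (C a * X i ^ 2 : MvPolynomial (Fin 3) k).IsHomogeneous 2 := by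
      simpa using (hC a).mul ((hX i).pow 2)
    have hmul (a : k) (i j : Fin 3) :
        (C a * X i * X j : MvPolynomial (Fin 3) k).IsHomogeneous 2 := by
      simpa using ((hC a).mul (hX i)).mul (hX j)
    exact (((((hsq _ _).add (hsq _ _)).add (hsq _ _)).add (hmul _ _ _)).add (hmul _ _ _)).add
      (hmul _ _ _)
  have hdvd := char_dvd_card_solutions (ringChar k) (f := p)
    (hhom.totalDegree_le.trans_lt (by simp))
  have hp : 1 < ringChar k := (CharP.char_is_prime k (ringChar k)).one_lt
  have h0 : MvPolynomial.eval (0 : Fin 3 → k) p = 0 := by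
    rw [heval]
    simp [ternaryForm]
  have hcard : 1 < Fintype.card {x : Fin 3 → k // MvPolynomial.eval x p = 0} :=
    hp.trans_le (Nat.le_of_dvd (Fintype.card_pos_iff.2 ⟨⟨0, h0⟩⟩) hdvd)
  have := Fintype.one_lt_card_iff_nontrivial.1 hcard
  obtain ⟨⟨x, hx⟩, hne⟩ := exists_ne (⟨0, h0⟩ : {x : Fin 3 → k // MvPolynomial.eval x p = 0})
  exact ⟨x, fun h ↦ hne (Subtype.ext h), heval x ▸ hx⟩

theorem exists_ternaryGrad_ne_zero {k : Type*} [Field k] {a₁ a₂ a₃ d e f : k}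
    (hH : halfDisc a₁ a₂ a₃ d e f ≠ 0) {x : Fin 3 → k} (hx : x ≠ 0)
    (hq : ternaryForm a₁ a₂ a₃ d e f x = 0) : ∃ j, ternaryGrad a₁ a₂ a₃ d e f x j ≠ 0 := by
  by_contra! hg
  have h0 := hg 0
  have h1 := hg 1
  have h2 := hg 2
  simp only [ternaryGrad, Matrix.cons_val] at h0 h1 h2
  rw [ternaryForm] at hq
  have key (i : Fin 3) : halfDisc a₁ a₂ a₃ d e f * x i ^ 2 = 0 := by
    rw [halfDisc]
    fin_cases i
    · simp only [Fin.zero_eta]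
      set g₁ := f * x 0 + 2 * a₂ * x 1 + d * x 2 with hg₁
      set g₂ := e * x 0 + d * x 1 + 2 * a₃ * x 2 with hg₂
      linear_combination (4 * a₂ * a₃ - d ^ 2) * hq - (a₃ * g₁ - d * g₂) * h1 - a₂ * g₂ * h2
    · simp only [Fin.mk_one]
      set g₀ := 2 * a₁ * x 0 + f * x 1 + e * x 2 with hg₀
      set g₂ := e * x 0 + d * x 1 + 2 * a₃ * x 2 with hg₂
      linear_combination (4 * a₁ * a₃ - e ^ 2) * hq - (a₃ * g₀ - e * g₂) * h0 - a₁ * g₂ * h2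
    · simp only [Fin.reduceFinMk]
      set g₀ := 2 * a₁ * x 0 + f * x 1 + e * x 2 with hg₀
      set g₁ := f * x 0 + 2 * a₂ * x 1 + d * x 2 with hg₁
      linear_combination (4 * a₁ * a₂ - f ^ 2) * hq - (a₂ * g₀ - f * g₁) * h0 - a₁ * g₁ * h1
  exact hx (funext fun i ↦ pow_eq_zero_iff two_ne_zero |>.1
    ((mul_eq_zero.1 (key i)).resolve_left hH))

theorem exists_ternaryForm_mem {R : Type*} [CommRing R] {P : Ideal R} [P.IsMaximal]
    [Finite (R ⧸ P)] {a₁ a₂ a₃ d e f : R} (hH : halfDisc a₁ a₂ a₃ d e f ∉ P) :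
    ∃ x : Fin 3 → R, ternaryForm a₁ a₂ a₃ d e f x ∈ P ∧
      ∃ j, ternaryGrad a₁ a₂ a₃ d e f x j ∉ P := by
  let := Ideal.Quotient.field P
  let π := Ideal.Quotient.mk P
  obtain ⟨y, hy, hq⟩ := exists_ne_zero_ternaryForm_eq_zero (π a₁) (π a₂) (π a₃) (π d) (π e) (π f)
  have hH' : halfDisc (π a₁) (π a₂) (π a₃) (π d) (π e) (π f) ≠ 0 := by
    rw [← map_halfDisc]
    rwa [Ne, Ideal.Quotient.eq_zero_iff_mem]
  obtain ⟨j, hj⟩ := exists_ternaryGrad_ne_zero hH' hy hq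
  choose x hx using fun i ↦ Ideal.Quotient.mk_surjective (y i)
  obtain rfl : (fun i ↦ π (x i)) = y := funext hx
  refine ⟨x, ?_, j, ?_⟩
  · rw [← Ideal.Quotient.eq_zero_iff_mem, map_ternaryForm]
    exact hq
  · rw [← Ideal.Quotient.eq_zero_iff_mem, map_ternaryGrad]
    exact hj

end Residue

section Completion

/-- A case of Hensel's lemma: `X ^ 2 - g X + r` has a root when `g` is a unit and `r` is
topologically nilpotent. -/
theorem exists_mul_self_sub_mul_add_eq_zero {K : Type*} [NormedField K] [IsUltrametricDist K]
    [CompleteSpace K] {g r : K} (hg : ‖g‖ = 1) (hr : ‖r‖ < 1) :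
    ∃ z : K, z * z - g * z + r = 0 := by
  have hg0 : g ≠ 0 := by
    rintro rfl
    simp at hg
  let T : K → K := fun z ↦ g⁻¹ * (z * z + r)
  let s : Set K := Metric.closedBall 0 ‖r‖
  have hmem {z : K} : z ∈ s ↔ ‖z‖ ≤ ‖r‖ := by simp [s]
  have hs : Set.MapsTo T s s := by
    intro z hz
    rw [hmem] at hz ⊢
    rw [norm_mul, norm_inv, hg, inv_one, one_mul]
    refine (IsUltrametricDist.norm_add_le_max _ _).trans (max_le ?_ le_rfl)
    rw [norm_mul]
    exact (mul_le_of_le_one_right (norm_nonneg _) (hz.trans hr.le)).trans hz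
  have hT : ContractingWith ‖r‖₊ (hs.restrict T s s) := by
    refine ⟨by exact_mod_cast hr, LipschitzWith.of_dist_le_mul fun z w ↦ ?_⟩
    rw [Subtype.dist_eq, Subtype.dist_eq, dist_eq_norm, dist_eq_norm, Set.MapsTo.val_restrict_apply,
      Set.MapsTo.val_restrict_apply, coe_nnnorm]
    have : T z - T w = g⁻¹ * (((z : K) + w) * (z - w)) := by
      simp only [T]
      ring
    rw [this, norm_mul, norm_mul, norm_inv, hg, inv_one, one_mul]
    gcongr
    exact (IsUltrametricDist.norm_add_le_max _ _).trans (max_le (hmem.1 z.2) (hmem.1 w.2))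
  obtain ⟨z, -, hz, -⟩ := hT.exists_fixedPoint' Metric.isClosed_closedBall.isComplete hs
    (hmem.2 (norm_nonneg _ |>.trans' norm_zero.le)) (edist_ne_top 0 _)
  refine ⟨z, ?_⟩
  have hz : g⁻¹ * (z * z + r) = z := hz
  rw [inv_mul_eq_iff_eq_mul₀ hg0] at hz
  linear_combination hz

theorem exists_root_adicCompletion {F R : Type*} [Field F] [CommRing R] [IsDedekindDomain R]
    [Algebra R F] [IsFractionRing R F] [Module.Finite ℤ R] [Module.Free ℤ R]
    (v : HeightOneSpectrum R) {g r : R} (hg : g ∉ v.asIdeal) (hr : r ∈ v.asIdeal) :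
    ∃ z : v.adicCompletion F, z * z - algebraMap F _ (algebraMap R F g) * z +
      algebraMap F _ (algebraMap R F r) = 0 := by
  have : IsUltrametricDist (v.adicCompletion F) := inferInstance
  exact exists_mul_self_sub_mul_add_eq_zero ((FinitePlace.norm_eq_one_iff_notMem F v g).2 hg)
    ((FinitePlace.norm_lt_one_iff_mem F v r).2 hr)

end Completion

section ZeroDivisor

open TensorProduct

/-- An algebra containing a non-scalar root of a polynomial that splits over `K` does not become
a division algebra over `K`. -/
theorem not_forall_isUnit_tensorProduct {F K A : Type*} [Field F] [Field K] [Algebra F K] [Ring A]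
    [Algebra F A] {n : A} {g r : F} (hn : n * n - g • n + algebraMap F A r = 0)
    (hn' : ∀ c : F, n ≠ algebraMap F A c) {z : K}
    (hz : z * z - algebraMap F K g * z + algebraMap F K r = 0) :
    ¬ ∀ x : K ⊗[F] A, x ≠ 0 → IsUnit x := by
  intro hdiv
  have hne (w : K) : (1 : K) ⊗ₜ[F] n - w ⊗ₜ[F] (1 : A) ≠ 0 := by
    intro h
    have hnp : n ∉ Submodule.span F {(1 : A)} := by
      rw [Submodule.mem_span_singleton]
      rintro ⟨c, hc⟩
      exact hn' c (by rw [← hc, Algebra.algebraMap_eq_smul_one])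
    obtain ⟨l, hl, hl'⟩ := Submodule.exists_le_ker_of_notMem hnp
    have hl1 : l 1 = 0 := hl' (Submodule.mem_span_singleton_self 1)
    have := congr_arg (fun t ↦ TensorProduct.rid F K (l.lTensor K t)) h
    simp [hl1] at this
    exact hl this
  have hprod : ((1 : K) ⊗ₜ[F] n - z ⊗ₜ[F] (1 : A)) *
      ((1 : K) ⊗ₜ[F] n - (algebraMap F K g - z) ⊗ₜ[F] (1 : A)) = 0 := by
    have h1 : z * (algebraMap F K g - z) = algebraMap F K r := by linear_combination -hz
    have h2 : n * n = g • n - algebraMap F A r := by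
      rw [← sub_eq_zero, ← hn]
      abel
    rw [sub_mul, mul_sub, mul_sub]
    simp only [Algebra.TensorProduct.tmul_mul_tmul, one_mul, mul_one, h1, h2]
    simp only [tmul_sub, sub_tmul, Algebra.algebraMap_eq_smul_one, tmul_smul, smul_tmul']
    abel
  exact hne _ (((hdiv _ (hne z)).mul_right_eq_zero).1 hprod)

end ZeroDivisor

section Ramified

open CliffordAlgebra

variable {F R W : Type*} [Field F] [CommRing R] [IsDedekindDomain R]
  [Algebra R F] [IsFractionRing R F] [AddCommGroup W] [Module F W]

theorem IsTernary.apply_sum {ψ : LinearMap.BilinForm F W} {m : Fin 3 → W} {a₁ a₂ a₃ d e f : F}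
    (hT : IsTernary ψ m a₁ a₂ a₃ d e f) (x : Fin 3 → F) :
    ψ (∑ i, x i • m i) (∑ i, x i • m i) = ternaryForm a₁ a₂ a₃ d e f x := by
  have h10 := hT.symm.eq (m 0) (m 1)
  have h20 := hT.symm.eq (m 0) (m 2)
  have h21 := hT.symm.eq (m 1) (m 2)
  simp only [Fin.sum_univ_three, map_add, LinearMap.add_apply, map_smul, LinearMap.smul_apply,
    smul_eq_mul, ternaryForm, ← hT.h₁, ← hT.h₂, ← hT.h₃, ← hT.hd, ← hT.he, ← hT.hf, h10, h20, h21]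
  ring

theorem IsTernary.polar_sum {ψ : LinearMap.BilinForm F W} {m : Fin 3 → W} {a₁ a₂ a₃ d e f : F}
    (hT : IsTernary ψ m a₁ a₂ a₃ d e f) (x : Fin 3 → F) (j : Fin 3) :
    QuadraticMap.polar (LinearMap.BilinMap.toQuadraticMap ψ) (∑ i, x i • m i) (m j) =
      ternaryGrad a₁ a₂ a₃ d e f x j := by
  have h10 := hT.symm.eq (m 0) (m 1)
  have h20 := hT.symm.eq (m 0) (m 2)
  have h21 := hT.symm.eq (m 1) (m 2)
  rw [LinearMap.BilinMap.polar_toQuadraticMap]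
  fin_cases j <;>
  · simp only [Fin.sum_univ_three, map_add, LinearMap.add_apply, map_smul, LinearMap.smul_apply,
      smul_eq_mul, ternaryGrad, ← hT.h₁, ← hT.h₂, ← hT.h₃, ← hT.hd, ← hT.he, ← hT.hf, h10, h20,
      h21, Matrix.cons_val, Fin.zero_eta, Fin.mk_one, Fin.reduceFinMk]
    ring

theorem halfDisc_mem_of_forall_isUnit [CharZero F] [Module.Finite ℤ R] [Module.Free ℤ R]
    {ψ : LinearMap.BilinForm F W} {m : Fin 3 → W} {a₁ a₂ a₃ d e f : R}
    (hT : IsTernary ψ m (algebraMap R F a₁) (algebraMap R F a₂) (algebraMap R F a₃)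
      (algebraMap R F d) (algebraMap R F e) (algebraMap R F f))
    (v : HeightOneSpectrum R)
    (hv : ∀ x : TensorProduct F (v.adicCompletion F)
        ↥(even (LinearMap.BilinMap.toQuadraticMap ψ)), x ≠ 0 → IsUnit x) :
    halfDisc a₁ a₂ a₃ d e f ∈ v.asIdeal := by
  by_contra hH
  have := v.isMaximal
  have : Finite (R ⧸ v.asIdeal) := v.asIdeal.finiteQuotientOfFreeOfNeBot v.ne_bot
  obtain ⟨x, hx, j, hj⟩ := exists_ternaryForm_mem hH
  set q := ternaryForm a₁ a₂ a₃ d e f x with hq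
  set g := ternaryGrad a₁ a₂ a₃ d e f x j with hg
  let Q := LinearMap.BilinMap.toQuadraticMap ψ
  let u : W := ∑ i, algebraMap R F (x i) • m i
  have hQu : Q u = algebraMap R F q := (hT.apply_sum _).trans (map_ternaryForm _ _ _ _ _ _ _ _).symm
  have hpol : QuadraticMap.polar Q u (m j) = algebraMap R F g :=
    (hT.polar_sum _ j).trans (map_ternaryGrad _ _ _ _ _ _ _ _ _).symm
  obtain ⟨b, hb⟩ : ∃ b : R, Q (m j) = algebraMap R F b := by
    fin_cases j
    exacts [⟨a₁, hT.h₁⟩, ⟨a₂, hT.h₂⟩, ⟨a₃, hT.h₃⟩]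
  have huv : ι Q u * ι Q (m j) + ι Q (m j) * ι Q u = algebraMap F _ (algebraMap R F g) := by
    rw [ι_mul_ι_add_swap, hpol]
  have huu : ι Q u * ι Q u = algebraMap F _ (algebraMap R F q) := by rw [ι_sq_scalar, hQu]
  have hmm : ι Q (m j) * ι Q (m j) = algebraMap F _ (algebraMap R F b) := by rw [ι_sq_scalar, hb]
  have hqb : q * b ∈ v.asIdeal := v.asIdeal.mul_mem_right _ hx
  let n : even Q := ⟨ι Q u * ι Q (m j), ι_mul_ι_mem_evenOdd_zero Q _ _⟩
  have hnn : (ι Q u * ι Q (m j)) * (ι Q u * ι Q (m j)) -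
      algebraMap R F g • (ι Q u * ι Q (m j)) +
        algebraMap F (CliffordAlgebra Q) (algebraMap R F (q * b)) = 0 := by
    have h1 : ι Q (m j) * ι Q u = algebraMap F _ (algebraMap R F g) - ι Q u * ι Q (m j) :=
      eq_sub_of_add_eq' huv
    have h2 : ι Q u * ι Q (m j) * (ι Q u * ι Q (m j)) =
        ι Q u * (ι Q (m j) * ι Q u) * ι Q (m j) := by simp only [mul_assoc]
    have h3 : ι Q u * (ι Q u * ι Q (m j)) * ι Q (m j) =
        (ι Q u * ι Q u) * (ι Q (m j) * ι Q (m j)) := by simp only [mul_assoc]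
    rw [h2, h1, mul_sub, sub_mul, h3, huu, hmm, map_mul, map_mul, ← Algebra.commutes,
      Algebra.smul_def, mul_assoc]
    abel
  obtain ⟨z, hz⟩ := exists_root_adicCompletion (F := F) v hj hqb
  refine not_forall_isUnit_tensorProduct (n := n) (g := algebraMap R F g)
    (r := algebraMap R F (q * b)) (Subtype.ext hnn) (fun c hc ↦ ?_) hz hv
  have hc' : ι Q u * ι Q (m j) = algebraMap F (CliffordAlgebra Q) c := congr_arg Subtype.val hc
  have hinj := algebraMap_cliffordAlgebra_injective Q
  have hrev := congr_arg reverse hc'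
  rw [reverse.map_mul, reverse_ι, reverse_ι, reverse.commutes] at hrev
  have h1 : c + c = algebraMap R F g := hinj (by rw [map_add, ← huv, hrev, hc'])
  have h2 : c * c - algebraMap R F g * c + algebraMap R F (q * b) = 0 := hinj (by
    rw [map_add, map_sub, map_mul, map_mul, ← hc', map_zero, ← Algebra.smul_def]
    exact hnn)
  have h3 : g * g = 4 * (q * b) := by
    apply IsFractionRing.injective R F
    rw [map_mul] at h2
    rw [map_mul, map_mul, map_mul, map_ofNat]
    rw [← h1] at h2 ⊢
    linear_combination -4 * h2
  exact hj (or_self_iff.1 (v.isPrime.mem_or_mem (h3 ▸ v.asIdeal.mul_mem_left 4 hqb)))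

end Ramified

section Discriminant

variable {R : Type*} [CommRing R]

theorem exists_notMem_mul_mem_finprod [IsDedekindDomain R] (S : Set (HeightOneSpectrum R))
    {P : Ideal R} [P.IsPrime]
    {x : R} (hx : ∀ v ∈ S, v.asIdeal = P → x ∈ P) :
    ∃ s ∉ P, s * x ∈ ∏ᶠ v ∈ S, v.asIdeal := by
  classical
  have hprod (T : Finset (HeightOneSpectrum R)) (hT : ∀ v ∈ T, v.asIdeal ≠ P) :
      ∃ s ∉ P, s ∈ ∏ v ∈ T, v.asIdeal := by
    obtain ⟨s, hs, hsP⟩ := SetLike.not_le_iff_exists.1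
      (show ¬ ∏ v ∈ T, v.asIdeal ≤ P by
        rw [Ideal.IsPrime.prod_le ‹_›]
        rintro ⟨v, hv, hle⟩
        exact hT v hv (v.isMaximal.eq_of_le (Ideal.IsPrime.ne_top ‹_›) hle))
    exact ⟨s, hsP, hs⟩
  by_cases hS : S.Finite
  · rw [finprod_mem_eq_finite_toFinset_prod _ hS]
    by_cases hP : ∃ v ∈ S, v.asIdeal = P
    · obtain ⟨v, hvS, rfl⟩ := hP
      obtain ⟨s, hs, hsT⟩ := hprod (hS.toFinset.erase v)
        fun w hw h ↦ (Finset.mem_erase.1 hw).1 (HeightOneSpectrum.ext h)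
      refine ⟨s, hs, ?_⟩
      rw [← Finset.prod_erase_mul _ _ (hS.mem_toFinset.2 hvS)]
      exact Ideal.mul_mem_mul hsT (hx v hvS rfl)
    · push Not at hP
      obtain ⟨s, hs, hsT⟩ := hprod hS.toFinset fun v hv ↦ hP v (hS.mem_toFinset.1 hv)
      exact ⟨s, hs, Ideal.mul_mem_right _ _ hsT⟩
  · refine ⟨1, P.one_notMem, ?_⟩
    rw [finprod_mem_eq_one_of_infinite, Ideal.one_eq_top]
    · trivial
    · rwa [Set.inter_eq_left.2 fun v _ ↦ by
        rw [Function.mem_mulSupport, Ideal.one_eq_top]; exact v.isPrime.ne_top]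

theorem exists_smul_mem_idealToF_mul {F : Type*} [Field F] [Algebra R F]
    {P : Ideal R} [P.IsPrime] {D : Ideal R} {x : R}
    (hx : ∃ s ∉ P, s * x ∈ D) {J : Submodule R F} {g : F} (hg : IsLocGen P J g) :
    ∃ s ∉ P, s • (algebraMap R F x * g) ∈ idealToF R F D * J := by
  obtain ⟨s, hs, hsD⟩ := hx
  obtain ⟨t, ht, htJ⟩ := hg.smul_mem
  refine ⟨s * t, P.primeCompl.mul_mem hs ht, ?_⟩
  rw [← smul_mul_smul_comm]
  refine Submodule.mul_mem_mul ⟨s * x, hsD, ?_⟩ htJ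
  rw [Algebra.linearMap_apply, map_mul, Algebra.smul_def]

end Discriminant

end Paper

section Statement15


variable (F : Type*) [Field F] [NumberField F]
variable (R : Type*) [CommRing R] [IsDedekindDomain R] [Algebra R F] [IsFractionRing R F]
  [IsIntegralClosure R ℤ F]
variable (V : Type*) [AddCommGroup V] [Module F V] [Module R V] [IsScalarTower R F V]

set_option synthInstance.maxHeartbeats 1000000 in
set_option maxHeartbeats 1000000 in
/-- With `(V,φ)` quaternary over a number field, `L` maximal,
`h ∈ V`, `q = φ[h] ≠ 0`, `W = (Fh)ᗮ`, `ψ = φ|_W`: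
`[(L∩W)~/(L∩W)]·(2φ(h,L))² = 2q[L̃/L]`; the discriminant of `A⁺(L∩W)` is
`q[L̃/L](2φ(h,L))⁻²` (expressed below without inverses: it is an integral ideal whose
square is `[A⁺(L∩W)~/A⁺(L∩W)]`); and the discriminant of the quaternion algebra
`A⁺(W)` divides `q[L̃/L](2φ(h,L))⁻²`. -/
theorem statement15
    (hV : Module.finrank F V = 4)
    (φ : LinearMap.BilinForm F V) (hsymm : φ.IsSymm)
    (hnd : LinearMap.BilinForm.Nondegenerate φ)
    (h : V) (hq : φ h h ≠ 0)
    (Wsub : Submodule F V) (hWsub : Wsub = LinearMap.ker (φ.flip h))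
    (L : Submodule R V) (hL : IsMaximalLat R F V φ L)
    -- D = the discriminant of the quaternion algebra A⁺(W)
    (D : Ideal R)
    (hD : D = ∏ᶠ v ∈ {v : HeightOneSpectrum R |
        ∀ x : TensorProduct F (v.adicCompletion F)
          ↥(CliffordAlgebra.even (LinearMap.BilinMap.toQuadraticMap
            (LinearMap.BilinForm.restrict φ Wsub))),
          x ≠ 0 → IsUnit x}, v.asIdeal) :
    -- [(L∩W)~/(L∩W)] = 2q[L̃/L](2φ(h,L))⁻²
    latIdx R F ↥Wsub
        (dualLat R F ↥Wsub (LinearMap.BilinForm.restrict φ Wsub)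
          (Submodule.comap ((Wsub.subtype).restrictScalars R) L))
        (Submodule.comap ((Wsub.subtype).restrictScalars R) L) *
      (Submodule.map (((2 : F) • (φ h)).restrictScalars R) L *
        Submodule.map (((2 : F) • (φ h)).restrictScalars R) L) =
      Submodule.span R {2 * φ h h} * latIdx R F V (dualLat R F V φ L) L ∧
    -- d(A⁺(L∩W)) = q[L̃/L](2φ(h,L))⁻² : integrality ...
    Submodule.span R {φ h h} * latIdx R F V (dualLat R F V φ L) L ≤
      Submodule.map (((2 : F) • (φ h)).restrictScalars R) L *
        Submodule.map (((2 : F) • (φ h)).restrictScalars R) L ∧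
    -- ... and its square is [A⁺(L∩W)~/A⁺(L∩W)]
    APlusDualIdx R F ↥Wsub (LinearMap.BilinForm.restrict φ Wsub)
        (Submodule.comap ((Wsub.subtype).restrictScalars R) L) *
      ((Submodule.map (((2 : F) • (φ h)).restrictScalars R) L *
          Submodule.map (((2 : F) • (φ h)).restrictScalars R) L) *
        (Submodule.map (((2 : F) • (φ h)).restrictScalars R) L *
          Submodule.map (((2 : F) • (φ h)).restrictScalars R) L)) =
      (Submodule.span R {φ h h} * latIdx R F V (dualLat R F V φ L) L) *
        (Submodule.span R {φ h h} * latIdx R F V (dualLat R F V φ L) L) ∧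
    -- D_{Q(ψ)} divides q[L̃/L](2φ(h,L))⁻²
    Submodule.span R {φ h h} * latIdx R F V (dualLat R F V φ L) L ≤
      idealToF R F D *
        (Submodule.map (((2 : F) • (φ h)).restrictScalars R) L *
          Submodule.map (((2 : F) • (φ h)).restrictScalars R) L) := by
  have hLint := hL.1
  have : Module.Free ℤ R := IsIntegralClosure.module_free ℤ ℚ F R
  have : IsNoetherian ℤ R := IsIntegralClosure.isNoetherian ℤ ℚ F R
  let M := Submodule.comap ((Wsub.subtype).restrictScalars R) L
  have hM : M.FG := fg_comap_subtype hLint.1.1 _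
  have hψM : ∀ x ∈ M, φ.restrict Wsub x x ∈ (algebraMap R F).range := fun x hx ↦ hLint.2 x hx
  refine ⟨eq_of_forall_isLocGen fun P _ ↦ ?_, le_of_forall_isLocGen fun P _ ↦ ?_,
    eq_of_forall_isLocGen fun P _ ↦ ?_, le_of_forall_exists_smul_mem fun P _ ↦ ?_⟩ <;>
  obtain ⟨m, a₁, a₂, a₃, d, e, f, c, g, hm, hmL, hT, hH, hc, hg, hdual, hcg⟩ :=
    exists_ternary hV hsymm hnd hq hWsub hLint P
  · refine ⟨_, hdual.mul (hc.mul hc), ?_⟩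
    convert (isLocGen_span_singleton P (2 * φ h h)).mul hg using 1
    linear_combination -2 * hcg
  · refine ⟨_, _, (isLocGen_span_singleton P (φ h h)).mul hg, hc.mul hc, 1, P.one_notMem,
      halfDisc a₁ a₂ a₃ d e f, ?_⟩
    rw [hcg, one_smul, Algebra.smul_def]
  · have hqg := (isLocGen_span_singleton P (φ h h)).mul hg
    refine ⟨_, ?_, hqg.mul hqg⟩
    have hH' := (map_ne_zero_iff _ (IsFractionRing.injective R F)).2 hH
    rw [map_halfDisc] at hH'
    convert (isLocGen_APlusDualIdx hM hψM hm hmL hT hH').mul ((hc.mul hc).mul (hc.mul hc)) using 1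
    rw [hcg, map_halfDisc]
    ring
  · refine ⟨_, (isLocGen_span_singleton P (φ h h)).mul hg, ?_⟩
    rw [hcg, hD]
    refine exists_smul_mem_idealToF_mul (exists_notMem_mul_mem_finprod _ fun v hv hvP ↦ ?_)
      (hc.mul hc)
    subst hvP
    exact halfDisc_mem_of_forall_isUnit hT v hv

end Statement15
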